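/- arXiv:0912.4240 — 9 statements merged into one kernel-verified Lean document; each statement's English description precedes it below -/
import Mathlib

section
/- For every real number x with |x| < π/2, the series Σ_{n≥0} E_n x^n/n! converges and equals sec x + tan x. -/
def IsAltPerm {n : ℕ} (w : Equiv.Perm (Fin n)) : Prop :=
  ∀ j : ℕ, ∀ h : j + 1 < n,
    (Even j → w ⟨j + 1, h⟩ < w ⟨j, Nat.lt_of_succ_lt h⟩) ∧
    (¬ Even j → w ⟨j, Nat.lt_of_succ_lt h⟩ < w ⟨j + 1, h⟩)

noncomputable def eulerNumber (n : ℕ) : ℕ :=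
  Nat.card {w : Equiv.Perm (Fin n) // IsAltPerm w}

noncomputable def insPerm {n : ℕ} (k : Fin (n+2)) (v : Equiv.Perm (Fin (n+1))) :
    Equiv.Perm (Fin (n+2)) :=
  Equiv.ofBijective (Fin.cons k (fun i => k.succAbove (Fin.rev (v i))) : Fin (n+2) → Fin (n+2)) (by
    rw [Finite.injective_iff_bijective.symm, Fin.cons_injective_iff]
    refine ⟨?_, fun a b h => by simpa using h⟩
    rintro ⟨i, hi⟩
    exact Fin.succAbove_ne _ _ hi)

@[simp] lemma insPerm_zero {n : ℕ} (k : Fin (n+2)) (v : Equiv.Perm (Fin (n+1))) :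
    insPerm k v 0 = k := by simp [insPerm]

@[simp] lemma insPerm_succ {n : ℕ} (k : Fin (n+2)) (v : Equiv.Perm (Fin (n+1))) (i : Fin (n+1)) :
    insPerm k v i.succ = k.succAbove (Fin.rev (v i)) := by simp [insPerm]

lemma isAlt_insPerm {n : ℕ} (k : Fin (n+2)) (v : Equiv.Perm (Fin (n+1))) :
    IsAltPerm (insPerm k v) ↔ IsAltPerm v ∧ n - (v 0).val < k.val := by
  have h0 : k.succAbove (Fin.rev (v 0)) < k ↔ n - (v 0).val < k.val := by
    rw [Fin.succAbove_lt_iff_castSucc_lt, Fin.lt_def]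
    simp [Fin.val_rev]
  have hs : ∀ j (h : j + 1 < n + 2), insPerm k v ⟨j+1, h⟩ =
      k.succAbove (Fin.rev (v ⟨j, by omega⟩)) := fun j h => insPerm_succ k v ⟨j, by omega⟩
  constructor
  · intro H
    constructor
    · intro j hj
      have := H (j+1) (by omega)
      rw [hs, hs] at this
      simp only [Fin.succAbove_lt_succAbove_iff, Fin.rev_lt_rev, Nat.even_add_one, not_not] at this
      exact ⟨this.2, this.1⟩
    · have := (H 0 (by omega)).1 (by simp)
      rw [hs] at this
      rw [← h0]
      simpa using this
  · rintro ⟨H, hk⟩ j hj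
    rcases j with _ | j
    · refine ⟨fun _ => ?_, fun h => absurd (by simp) h⟩
      rw [hs]
      simpa using h0.2 hk
    · have := H j (by omega)
      rw [hs, hs]
      simp only [Fin.succAbove_lt_succAbove_iff, Fin.rev_lt_rev, Nat.even_add_one, not_not]
      exact ⟨this.2, this.1⟩

noncomputable def entr (n k : ℕ) : ℕ :=
  Nat.card {w : Equiv.Perm (Fin (n+1)) // IsAltPerm w ∧ (w 0).val = k}

lemma entr_succ (n k : ℕ) (hk : k < n + 2) : entr (n+1) k =
    Nat.card {v : Equiv.Perm (Fin (n+1)) // IsAltPerm v ∧ n - (v 0).val < k} := by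
  symm
  refine Nat.card_eq_of_bijective (fun v => ⟨insPerm ⟨k, hk⟩ v.1,
    (isAlt_insPerm _ _).2 v.2, by simp⟩) ⟨?_, ?_⟩
  · rintro ⟨v, hv⟩ ⟨v', hv'⟩ h
    simp only [Subtype.mk.injEq] at h ⊢
    refine Equiv.ext fun i => ?_
    have := congrArg (fun w => w i.succ) h
    simp only [insPerm_succ] at this
    simpa using this
  · rintro ⟨w, hw, hw0⟩
    have hne : ∀ i : Fin (n+1), ∃ j, (⟨k, hk⟩ : Fin (n+2)).succAbove j = w i.succ := by
      intro i
      apply Fin.exists_succAbove_eq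
      intro h
      have : w i.succ = w 0 := by rw [h]; ext; exact hw0.symm
      exact absurd (w.injective this) (Fin.succ_ne_zero i)
    choose f hf using hne
    have hinj : Function.Injective f := by
      intro a b hab
      have : w a.succ = w b.succ := by rw [← hf, ← hf, hab]
      simpa using this
    let v : Equiv.Perm (Fin (n+1)) :=
      (Equiv.ofBijective f (Finite.injective_iff_bijective.1 hinj)).trans Fin.revPerm
    have hv : insPerm ⟨k, hk⟩ v = w := by
      ext i
      refine Fin.cases ?_ (fun i => ?_) i
      · simp [hw0]
      · rw [insPerm_succ, ← hf]; simp [v]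
    refine ⟨⟨v, ?_⟩, by simp [hv]⟩
    have := (isAlt_insPerm ⟨k, hk⟩ v).1 (by rw [hv]; exact hw)
    exact this

lemma entr_zero_zero : entr 0 0 = 1 := by
  unfold entr
  rw [Nat.card_eq_one_iff_unique]
  haveI : Subsingleton (Equiv.Perm (Fin (0 + 1))) :=
    inferInstanceAs (Subsingleton (Equiv.Perm (Fin 1)))
  refine ⟨⟨fun a b => Subtype.ext (Subsingleton.elim _ _)⟩, ⟨⟨1, ?_, by simp⟩⟩⟩
  intro j h; omega

lemma entr_succ_zero (n : ℕ) : entr (n+1) 0 = 0 := by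
  rw [entr_succ _ _ (by omega)]
  simp

lemma entr_self (n : ℕ) : entr n n = eulerNumber n := by
  rcases n with _ | n
  · rw [entr_zero_zero]
    unfold eulerNumber
    symm
    rw [Nat.card_eq_one_iff_unique]
    refine ⟨⟨fun a b => Subtype.ext (Subsingleton.elim _ _)⟩, ⟨⟨1, ?_⟩⟩⟩
    intro j h; omega
  · rw [entr_succ _ _ (by omega)]
    unfold eulerNumber
    refine Nat.card_congr (Equiv.subtypeEquivRight fun v => ?_)
    simp only [and_iff_left_iff_imp]
    intro; omega

lemma entr_step (n k : ℕ) (hk : k ≤ n) :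
    entr (n+1) (k+1) = entr (n+1) k + entr n (n-k) := by
  classical
  rw [entr_succ _ _ (by omega), entr_succ _ _ (by omega), entr]
  simp only [Nat.card_eq_fintype_card, Fintype.card_subtype]
  rw [← Finset.card_union_of_disjoint]
  · congr 1
    ext v
    have := (v 0).isLt
    simp only [Finset.mem_filter, Finset.mem_univ, true_and, Finset.mem_union, ← and_or_left]
    refine and_congr_right fun _ => ?_
    omega
  · rw [Finset.disjoint_left]
    intro v
    have := (v 0).isLt
    simp only [Finset.mem_filter, Finset.mem_univ, true_and]
    omega

/-- difference operator -/
def dif (F : ℕ → ℕ → ℤ) (a b : ℕ) : ℤ := F (a+1) b - F a (b+1)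

lemma dif_expand (F : ℕ → ℕ → ℤ) (a b : ℕ) :
    F a b = ∑ p ∈ Finset.HasAntidiagonal.antidiagonal a, (a.choose p.1 : ℤ) * (dif^[p.1] F) 0 (p.2 + b) := by
  induction a generalizing F b with
  | zero => simp
  | succ a ih =>
    have h1 : F (a+1) b = F a (b+1) + dif F a b := by simp [dif]
    rw [h1, ih F, ih (dif F)]
    rw [Finset.sum_antidiagonal_choose_succ_mul (fun i j => (dif^[i] F) 0 (j + b))]
    congr 1
    · refine Finset.sum_congr rfl fun p _ => ?_
      rw [add_right_comm, add_assoc]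
    · refine Finset.sum_congr rfl fun p hp => ?_
      rw [Finset.HasAntidiagonal.mem_antidiagonal] at hp
      rw [Nat.choose_symm_of_eq_add hp.symm]
      simp [Function.iterate_succ]

noncomputable def FF (a b : ℕ) : ℤ := entr (a+b) a

lemma dif_FF (a b : ℕ) : dif FF a b = FF b a := by
  have h := entr_step (a+b) a (by omega)
  simp only [dif, FF]
  rw [show a + 1 + b = a + b + 1 by omega, show a + (b+1) = a + b + 1 by omega, h,
    show a + b - a = b by omega, Nat.add_comm b a]
  push_cast; ring

lemma dif_dif_FF : dif (dif FF) = - FF := by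
  ext a b
  have : dif (dif FF) a b = dif FF (a+1) b - dif FF a (b+1) := rfl
  rw [this, dif_FF, dif_FF]
  have := dif_FF b a
  simp only [dif] at this
  simp only [Pi.neg_apply]
  omega

lemma dif_negF (F : ℕ → ℕ → ℤ) : dif (-F) = - dif F := by
  ext a b; simp [dif]; ring

lemma dif_iter_neg (m : ℕ) (F : ℕ → ℕ → ℤ) : dif^[m] (-F) = - dif^[m] F := by
  induction m generalizing F with
  | zero => rfl
  | succ m ih => simp [Function.iterate_succ, dif_negF, ih]

lemma dif_add_two (m : ℕ) : dif^[m+2] FF = - dif^[m] FF := by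
  simp only [Function.iterate_succ, Function.comp]
  rw [dif_dif_FF, dif_iter_neg]

lemma FF_zero (b : ℕ) : FF 0 b = if b = 0 then 1 else 0 := by
  rcases b with _ | b
  · simp [FF, entr_zero_zero]
  · simp [FF, entr_succ_zero]

lemma dif_FF_zero (b : ℕ) : dif FF 0 b = eulerNumber b := by
  rw [dif_FF, FF, Nat.add_zero, entr_self]

def cc : ℕ → ℤ
  | 0 => 1
  | 1 => 0
  | (n+2) => - cc n

def ss : ℕ → ℤ
  | 0 => 0
  | 1 => 1
  | (n+2) => - ss n

lemma dif_iter_FF (m b : ℕ) :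
    (dif^[m] FF) 0 b = cc m * (if b = 0 then 1 else 0) + ss m * eulerNumber b := by
  induction m using Nat.twoStepInduction with
  | zero => simp [cc, ss, FF_zero]
  | one => simp [cc, ss, dif_FF_zero]
  | more m ih _ => rw [dif_add_two, Pi.neg_apply, Pi.neg_apply, ih, cc, ss]; ring

lemma euler_rec (n : ℕ) : (eulerNumber n : ℤ) =
    cc n + ∑ p ∈ Finset.HasAntidiagonal.antidiagonal n, (n.choose p.1 : ℤ) * (ss p.1 * eulerNumber p.2) := by
  have h := dif_expand FF n 0
  rw [FF, Nat.add_zero, entr_self] at h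
  rw [h]
  simp only [Nat.add_zero, dif_iter_FF, mul_add, Finset.sum_add_distrib]
  congr 1
  rw [Finset.Nat.sum_antidiagonal_eq_sum_range_succ
    (fun i j => (n.choose i : ℤ) * (cc i * if j = 0 then 1 else 0)), Finset.sum_range_succ]
  rw [Finset.sum_eq_zero]
  · simp
  · intro i hi
    rw [Finset.mem_range] at hi
    rw [if_neg (by omega)]; simp

lemma iter_cos_sin (m : ℕ) : iteratedDeriv m Complex.cos 0 = (cc m : ℂ) ∧
    iteratedDeriv m Complex.sin 0 = (ss m : ℂ) := by
  induction m using Nat.twoStepInduction with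
  | zero => simp [cc, ss]
  | one => simp [cc, ss]
  | more m ih _ =>
    rw [Complex.iteratedDeriv_add_one_cos, Complex.iteratedDeriv_add_one_sin,
      Complex.iteratedDeriv_add_one_sin, Complex.iteratedDeriv_add_one_cos, Pi.neg_apply,
      Pi.neg_apply, ih.1, ih.2]
    simp [cc, ss]

noncomputable def secTan (z : ℂ) : ℂ := 1 / Complex.cos z + Complex.tan z

lemma cos_ne_zero_ball {z : ℂ} (hz : z ∈ Metric.ball (0 : ℂ) (Real.pi / 2)) :
    Complex.cos z ≠ 0 := by
  intro h
  obtain ⟨k, rfl⟩ := Complex.cos_eq_zero_iff.1 h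
  rw [mem_ball_zero_iff] at hz
  have e : ((2 * (k : ℂ) + 1) * Real.pi / 2) = (((2 * k + 1 : ℤ) : ℝ) * (Real.pi / 2) : ℝ) := by
    push_cast; ring
  rw [e, Complex.norm_real, norm_mul, Real.norm_eq_abs, Real.norm_eq_abs,
    abs_of_pos Real.pi_div_two_pos, ← Int.cast_abs] at hz
  have h1 : (1 : ℝ) ≤ ((|2 * k + 1| : ℤ) : ℝ) := by
    exact_mod_cast Int.one_le_abs (by omega)
  nlinarith [Real.pi_div_two_pos]

lemma secTan_diff : DifferentiableOn ℂ secTan (Metric.ball 0 (Real.pi / 2)) := by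
  intro z hz
  have hc := cos_ne_zero_ball hz
  apply DifferentiableAt.differentiableWithinAt
  unfold secTan
  exact ((differentiableAt_const _).div Complex.differentiable_cos.differentiableAt hc).add
    (Complex.differentiableAt_tan.2 hc)

lemma secTan_eq : secTan =ᶠ[nhds 0] Complex.cos + Complex.sin * secTan := by
  filter_upwards [Metric.ball_mem_nhds (0 : ℂ) Real.pi_div_two_pos] with z hz
  have hc := cos_ne_zero_ball hz
  simp only [Pi.add_apply, Pi.mul_apply, secTan, Complex.tan_eq_sin_div_cos]
  field_simp
  linear_combination -Complex.sin_sq_add_cos_sq z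

lemma secTan_rec (n : ℕ) : iteratedDeriv n secTan 0 =
    cc n + ∑ p ∈ Finset.HasAntidiagonal.antidiagonal n,
      (n.choose p.1 : ℂ) * (ss p.1 * iteratedDeriv p.2 secTan 0) := by
  have hf : ContDiffAt ℂ n secTan 0 :=
    (secTan_diff.analyticAt (Metric.ball_mem_nhds (0 : ℂ) Real.pi_div_two_pos)).contDiffAt
  conv_lhs => rw [secTan_eq.iteratedDeriv_eq n]
  have hm : ContDiffAt ℂ n (Complex.sin * secTan) 0 := Complex.contDiff_sin.contDiffAt.mul hf
  rw [iteratedDeriv_add Complex.contDiff_cos.contDiffAt hm,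
    iteratedDeriv_mul Complex.contDiff_sin.contDiffAt hf, (iter_cos_sin n).1,
    Finset.Nat.sum_antidiagonal_eq_sum_range_succ
      (fun i j => (n.choose i : ℂ) * (ss i * iteratedDeriv j secTan 0))]
  congr 1
  refine Finset.sum_congr rfl fun i _ => ?_
  rw [(iter_cos_sin i).2, mul_assoc]

lemma secTan_coeff (n : ℕ) : iteratedDeriv n secTan 0 = (eulerNumber n : ℂ) := by
  induction n using Nat.strong_induction_on with
  | _ n ih =>
    have h : (eulerNumber n : ℂ) = _ := congrArg (Int.cast : ℤ → ℂ) (euler_rec n)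
    rw [secTan_rec, h]
    push_cast
    congr 1
    refine Finset.sum_congr rfl fun p hp => ?_
    rw [Finset.HasAntidiagonal.mem_antidiagonal] at hp
    rcases Nat.eq_zero_or_pos p.1 with h0 | h0
    · simp [h0, ss]
    · rw [ih p.2 (by omega)]

theorem euler_gf (x : ℝ) (hx : |x| < Real.pi / 2) :
    HasSum (fun n : ℕ => (eulerNumber n : ℝ) * x ^ n / n.factorial)
      (1 / Real.cos x + Real.tan x) := by
  have hz : (x : ℂ) ∈ Metric.ball (0 : ℂ) (Real.pi / 2) := by
    rw [mem_ball_zero_iff, Complex.norm_real]; exact hx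
  have h := Complex.hasSum_taylorSeries_on_ball secTan_diff hz
  simp only [secTan_coeff] at h
  rw [← Complex.hasSum_ofReal]
  have e : ((1 / Real.cos x + Real.tan x : ℝ) : ℂ) = secTan x := by simp [secTan]
  rw [e]
  have e2 : (fun n : ℕ => (((eulerNumber n : ℝ) * x ^ n / n.factorial : ℝ) : ℂ)) =
      fun n : ℕ => ((n.factorial : ℂ))⁻¹ • ((x : ℂ) - 0) ^ n • (eulerNumber n : ℂ) := by
    funext n
    simp only [smul_eq_mul, sub_zero]
    push_cast
    ring
  rw [← e2] at h
  exact h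
end

section
/- For all k, n ≥ 1, f_k(n) = Σ_{j=1}^{n} Σ_{i_1+⋯+i_j = n, each i_r > 0} (−1)^{n−j} · (kn)!/((i_1 k)! (i_2 k)! ⋯ (i_j k)!), i.e., f_k(n) is given by the stated inclusion-exclusion sum over compositions (i_1,…,i_j) of n into positive parts. -/
/-- Permutations `a_1 ⋯ a_m` (1-indexed) with `a_i > a_{i+1}` iff `k ∣ i`.
Here `j` is the 0-indexed position, so the 1-indexed position is `j+1`. -/
def DescIffMult (k : ℕ) {m : ℕ} (w : Equiv.Perm (Fin m)) : Prop :=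
  ∀ j : ℕ, ∀ h : j + 1 < m,
    (w ⟨j + 1, h⟩ < w ⟨j, Nat.lt_of_succ_lt h⟩ ↔ k ∣ (j + 1))

noncomputable def fkn (k n : ℕ) : ℕ :=
  Nat.card {w : Equiv.Perm (Fin (k * n)) // DescIffMult k w}

namespace FknAux

open Finset

/-- Weight of a composition. -/
noncomputable def wt (k : ℕ) {n : ℕ} (c : Composition n) : ℚ :=
  (-1 : ℚ) ^ (n - c.length) / ((c.blocks.map fun i => ((i * k).factorial : ℚ)).prod)

/-- Prepend a block. -/
def consComp (n : ℕ) (p : Σ i : Fin (n + 1), Composition (n - i)) : Composition (n + 1) where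
  blocks := (p.1.1 + 1) :: p.2.blocks
  blocks_pos := by
    intro i hi
    rcases List.mem_cons.1 hi with rfl | h
    · omega
    · exact p.2.blocks_pos h
  blocks_sum := by
    have := p.2.blocks_sum
    have := p.1.2
    simp only [List.sum_cons]
    omega

lemma consComp_bij (n : ℕ) : Function.Bijective (consComp n) := by
  constructor
  · rintro ⟨i, c⟩ ⟨j, d⟩ h
    have h' := congrArg Composition.blocks h
    simp only [consComp, List.cons.injEq] at h'
    obtain ⟨h1, h2⟩ := h'
    have : i = j := by apply Fin.ext; omega
    subst this
    have : c = d := Composition.ext h2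
    rw [this]
  · intro c
    rcases hb : c.blocks with _ | ⟨a, t⟩
    · have := c.blocks_sum
      rw [hb] at this
      simp at this
    · have hs := c.blocks_sum
      have hp : ∀ {i}, i ∈ c.blocks → 0 < i := c.blocks_pos
      rw [hb] at hs hp
      have ha : 0 < a := hp (by simp)
      simp only [List.sum_cons] at hs
      refine ⟨⟨⟨a - 1, by omega⟩, ⟨t, fun h => hp (by simp [h]), ?_⟩⟩, ?_⟩
      · simp only; omega
      · apply Composition.ext
        simp only [consComp, hb]
        congr 1; omega

lemma wt_cons (k n : ℕ) (i : Fin (n + 1)) (c : Composition (n - i)) :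
    wt k (consComp n ⟨i, c⟩) = (-1 : ℚ) ^ (i : ℕ) / (((i + 1 : ℕ) * k).factorial : ℚ) * wt k c := by
  have h1 : (consComp n ⟨i, c⟩).length = c.length + 1 := by simp [consComp, Composition.length]
  have h2 := c.length_le
  have h3 : n + 1 - (c.length + 1) = i + (n - i - c.length) := by have := i.2; omega
  unfold wt
  rw [h1, h3, pow_add]
  simp only [consComp, List.map_cons, List.prod_cons]
  rw [div_mul_div_comm]

/-- Sum of weights. -/
noncomputable def G (k n : ℕ) : ℚ := ∑ c : Composition n, wt k c

lemma G_succ (k n : ℕ) : G k (n + 1) =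
    ∑ i : Fin (n + 1), (-1 : ℚ) ^ (i : ℕ) / (((i + 1 : ℕ) * k).factorial : ℚ) * G k (n - i) := by
  unfold G
  rw [← (consComp_bij n).sum_comp, Fintype.sum_sigma]
  refine Finset.sum_congr rfl fun i _ => ?_
  rw [Finset.mul_sum]
  exact Finset.sum_congr rfl fun c _ => wt_cons k n i c

lemma G_zero (k : ℕ) : G k 0 = 1 := by
  have h : ∀ c : Composition 0, wt k c = 1 := by
    intro c
    have : c.blocks = [] := c.blocks_eq_nil.2 rfl
    simp [wt, this]
  unfold G
  have : Fintype.card (Composition 0) = 1 := by simp [composition_card]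
  simp [h, this]

variable {α : Type*} [LinearOrder α]

/-- All orderings of a finite set. -/
def L (S : Finset α) : Finset (List α) := ⟨Multiset.lists S.val, Multiset.lists_nodup_finset S⟩

lemma mem_L {S : Finset α} {l : List α} : l ∈ L S ↔ l.Nodup ∧ l.toFinset = S := by
  simp only [L, Finset.mem_mk, Multiset.mem_lists_iff]
  constructor
  · intro h
    have hn : l.Nodup := by
      have := S.nodup
      rw [h] at this
      exact this
    refine ⟨hn, ?_⟩
    ext a
    rw [List.mem_toFinset, ← Finset.mem_val, h]
    rfl
  · rintro ⟨h1, rfl⟩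
    rw [List.toFinset_val, h1.dedup]
    rfl

lemma length_L {S : Finset α} {l : List α} (h : l ∈ L S) : l.length = S.card := by
  obtain ⟨h1, rfl⟩ := mem_L.1 h
  exact (List.toFinset_card_of_nodup h1).symm

/-- Descent pattern. -/
def Pat (P : ℕ → Prop) (l : List α) : Prop :=
  ∀ j, ∀ h : j + 1 < l.length, (l[j + 1] < l[j] ↔ P (j + 1))

/-- Descent pattern except at position `a`. -/
def PatE (a : ℕ) (P : ℕ → Prop) (l : List α) : Prop :=
  ∀ j, ∀ h : j + 1 < l.length, j + 1 ≠ a → (l[j + 1] < l[j] ↔ P (j + 1))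

open scoped Classical in
/-- Lists with pattern. -/
noncomputable def D (k i : ℕ) (S : Finset α) : Finset (List α) :=
  {l ∈ L S | Pat (fun p => k ∣ p ∧ i * k ≤ p) l}

open scoped Classical in
/-- Lists with pattern. -/
noncomputable def B (k i : ℕ) (S : Finset α) : Finset (List α) :=
  {l ∈ L S | PatE (i * k) (fun p => k ∣ p ∧ i * k ≤ p) l}

open scoped Classical in
/-- Lists with pattern. -/
noncomputable def F (k : ℕ) (S : Finset α) : Finset (List α) :=
  {l ∈ L S | Pat (fun p => k ∣ p) l}

lemma D_one (k : ℕ) (S : Finset α) : D k 1 S = F k S := by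
  classical
  ext l
  simp only [D, F, mem_filter]
  simp only [Pat]
  have : ∀ j, (k ∣ j + 1 ∧ 1 * k ≤ j + 1) ↔ k ∣ j + 1 := fun j =>
    ⟨fun h => h.1, fun h => ⟨h, by rw [one_mul]; exact Nat.le_of_dvd (by omega) h⟩⟩
  simp only [this]

lemma D_last (k n : ℕ) (S : Finset α) (hS : S.card = n * k) : D k n S = B k n S := by
  classical
  ext l
  simp only [D, B, mem_filter]
  simp only [Pat, PatE]
  refine and_congr_right fun hl => ?_
  have := length_L hl
  refine forall_congr' fun j => forall_congr' fun h => ?_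
  have : j + 1 ≠ n * k := by omega
  simp [this]

lemma key (k i p : ℕ) (hk : 1 ≤ k) (hd : k ∣ p) (hne : p ≠ i * k) :
    i * k ≤ p ↔ (i + 1) * k ≤ p := by
  obtain ⟨q, rfl⟩ := hd
  rw [mul_comm k q] at *
  have : q ≠ i := fun h => hne (by rw [h])
  rw [Nat.mul_le_mul_right_iff hk, Nat.mul_le_mul_right_iff hk]
  omega

lemma B_split (k i n : ℕ) (hk : 1 ≤ k) (hi : 1 ≤ i) (hin : i < n) (S : Finset α)
    (hS : S.card = n * k) : (B k i S).card = (D k i S).card + (D k (i + 1) S).card := by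
  classical
  have hik : 1 ≤ i * k := Nat.mul_pos hi hk
  have hlt : i * k < n * k := Nat.mul_lt_mul_of_pos_right hin hk
  rw [← card_union_of_disjoint]
  · congr 1
    ext l
    simp only [D, B, mem_union, mem_filter, ← and_or_left]
    refine and_congr_right fun hl => ?_
    have hlen := length_L hl
    constructor
    · intro h
      by_cases hd : l[i * k - 1 + 1]'(by omega) < l[i * k - 1]'(by omega)
      · left
        intro j hj
        by_cases hja : j + 1 = i * k
        · have : j = i * k - 1 := by omega
          subst this
          simp only [hd, true_iff]
          rw [hja]
          simp
        · exact h j hj hja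
      · right
        intro j hj
        by_cases hja : j + 1 = i * k
        · have : j = i * k - 1 := by omega
          subst this
          simp only [hd, false_iff]
          rw [hja, not_and, add_mul]
          intro; omega
        · rw [h j hj hja]
          refine and_congr_right fun hd => key k i _ hk hd hja
    · rintro (h | h) j hj hja
      · exact h j hj
      · rw [h j hj]
        exact and_congr_right fun hd => (key k i _ hk hd hja).symm
  · rw [Finset.disjoint_left]
    intro l h1 h2
    simp only [D, mem_filter] at h1 h2
    have hlen := length_L h1.1
    have a := h1.2 (i * k - 1) (by omega)
    have b := h2.2 (i * k - 1) (by omega)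
    rw [a] at b
    have e : i * k - 1 + 1 = i * k := by omega
    simp only [e] at b
    have := (b.1 ⟨Dvd.intro_left i rfl, le_rfl⟩).2
    rw [add_mul] at this
    omega

lemma tele (k n : ℕ) (hk : 1 ≤ k) (S : Finset α) (hS : S.card = (n + 1) * k) (m : ℕ) (hm : m ≤ n) :
    ((F k S).card : ℚ) = ∑ i ∈ range m, (-1 : ℚ) ^ i * (B k (i + 1) S).card
      + (-1) ^ m * (D k (m + 1) S).card := by
  induction m with
  | zero => simp [D_one]
  | succ m ih =>
    rw [ih (by omega), sum_range_succ, B_split k (m + 1) (n + 1) hk (by omega) (by omega) S hS]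
    push_cast
    ring

lemma F_eq (k n : ℕ) (hk : 1 ≤ k) (S : Finset α) (hS : S.card = (n + 1) * k) :
    ((F k S).card : ℚ) = ∑ i ∈ range (n + 1), (-1 : ℚ) ^ i * (B k (i + 1) S).card := by
  rw [tele k n hk S hS n le_rfl, D_last k (n + 1) S hS, sum_range_succ]

lemma PatE_append (k i : ℕ) (hk : 1 ≤ k) (u v : List α) (hu : u.length = i * k)
    (hn : u.Nodup) :
    PatE (i * k) (fun p => k ∣ p ∧ i * k ≤ p) (u ++ v) ↔
      u.SortedLT ∧ Pat (fun p => k ∣ p) v := by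
  constructor
  · intro h
    constructor
    · rw [List.sortedLT_iff_isChain, List.isChain_iff_getElem]
      intro j hj
      have := h j (by simp; omega) (by omega)
      rw [List.getElem_append_left hj, List.getElem_append_left (by omega)] at this
      have h2 : ¬ (i * k ≤ j + 1) := by omega
      simp only [h2, and_false, iff_false, not_lt] at this
      refine lt_of_le_of_ne this fun e => ?_
      have := (hn.getElem_inj_iff).1 e
      omega
    · intro j hj
      have := h (u.length + j) (by simp; omega) (by omega)
      rw [List.getElem_append_right (by omega), List.getElem_append_right (by omega)] at this
      have e1 : u.length + j + 1 - u.length = j + 1 := by omega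
      have e2 : u.length + j - u.length = j := by omega
      simp only [e1, e2] at this
      rw [this, hu, add_assoc, Nat.dvd_add_right (Dvd.intro_left i rfl)]
      simp
  · rintro ⟨h1, h2⟩ j hj hne
    rw [List.sortedLT_iff_isChain, List.isChain_iff_getElem] at h1
    rw [List.length_append] at hj
    by_cases hj2 : j + 1 < u.length
    · rw [List.getElem_append_left hj2, List.getElem_append_left (by omega)]
      have h3 : ¬ (i * k ≤ j + 1) := by omega
      simp only [h3, and_false, iff_false, not_lt]
      exact (h1 j hj2).le
    · obtain ⟨j', rfl⟩ : ∃ j', j = u.length + j' := ⟨j - u.length, by omega⟩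
      rw [List.getElem_append_right (by omega), List.getElem_append_right (by omega)]
      have e1 : u.length + j' + 1 - u.length = j' + 1 := by omega
      have e2 : u.length + j' - u.length = j' := by omega
      simp only [e1, e2]
      rw [h2 j' (by omega), hu, add_assoc, Nat.dvd_add_right (Dvd.intro_left i rfl)]
      simp

lemma B_card (k i : ℕ) (hk : 1 ≤ k) (S : Finset α) (hS : i * k ≤ S.card) :
    (B k i S).card = ∑ T ∈ powersetCard (i * k) S, (F k (S \ T)).card := by
  classical
  rw [← card_sigma]
  refine card_nbij' (fun l => ⟨(l.take (i * k)).toFinset, l.drop (i * k)⟩)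
    (fun p => p.1.sort ++ p.2) ?_ ?_ ?_ ?_
  · intro l hl
    simp only [B, coe_filter, Set.mem_ofPred_eq] at hl
    obtain ⟨hl, hp⟩ := hl
    have hlen := length_L hl
    obtain ⟨hn, ht⟩ := mem_L.1 hl
    rw [← List.take_append_drop (i * k) l] at hp hn ht
    have hu : (l.take (i * k)).length = i * k := by simp; omega
    rw [List.nodup_append'] at hn
    rw [PatE_append k i hk _ _ hu hn.1] at hp
    simp only [coe_sigma, Set.mem_sigma_iff, mem_coe, mem_powersetCard, F, mem_filter, mem_L]
    rw [List.toFinset_append] at ht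
    refine ⟨⟨?_, ?_⟩, ⟨hn.2.1, ?_⟩, hp.2⟩
    · rw [← ht]; exact subset_union_left
    · rw [List.toFinset_card_of_nodup hn.1, hu]
    · rw [← ht, union_sdiff_cancel_left]
      exact List.disjoint_toFinset_iff_disjoint.2 hn.2.2
  · rintro ⟨T, l⟩ hl
    simp only [coe_sigma, Set.mem_sigma_iff, mem_coe, mem_powersetCard, F, mem_filter, mem_L] at hl
    obtain ⟨⟨hTS, hT⟩, ⟨hn, ht⟩, hp⟩ := hl
    simp only [B, mem_coe, mem_filter, mem_L]
    refine ⟨⟨?_, ?_⟩, ?_⟩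
    · rw [List.nodup_append']
      refine ⟨T.sort_nodup _, hn, ?_⟩
      rw [← List.disjoint_toFinset_iff_disjoint, ht, sort_toFinset]
      exact disjoint_sdiff
    · rw [List.toFinset_append, ht, sort_toFinset, union_sdiff_of_subset hTS]
    · rw [PatE_append k i hk _ _ (by simp [hT]) (T.sort_nodup _)]
      exact ⟨T.sortedLT_sort, hp⟩
  · intro l hl
    simp only [B, coe_filter, Set.mem_ofPred_eq] at hl
    obtain ⟨hl, hp⟩ := hl
    have hlen := length_L hl
    obtain ⟨hn, ht⟩ := mem_L.1 hl
    rw [← List.take_append_drop (i * k) l] at hp hn ht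
    have hu : (l.take (i * k)).length = i * k := by simp; omega
    rw [List.nodup_append'] at hn
    rw [PatE_append k i hk _ _ hu hn.1] at hp
    have := (List.toFinset_sort (r := (· ≤ ·)) hn.1).2
      (List.sortedLE_iff_pairwise.1 hp.1.sortedLE)
    simp only
    rw [this, List.take_append_drop]
  · rintro ⟨T, l⟩ hl
    simp only [coe_sigma, Set.mem_sigma_iff, mem_coe, mem_powersetCard] at hl
    have hlen : T.sort.length = i * k := by simp [hl.1.2]
    simp only
    rw [List.take_left' hlen, List.drop_left' hlen, sort_toFinset]

lemma main (k : ℕ) (hk : 1 ≤ k) (n : ℕ) : ∀ S : Finset α, S.card = n * k →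
    ((F k S).card : ℚ) = (n * k).factorial * G k n := by
  classical
  induction n using Nat.strong_induction_on with
  | _ n ih =>
  intro S hS
  rcases n with _ | n
  · have : S = ∅ := by simpa using hS
    subst this
    have : F k (∅ : Finset α) = {[]} := by
      ext l
      simp only [F, mem_filter, mem_L, mem_singleton, List.toFinset_eq_empty_iff]
      constructor
      · exact fun h => h.1.2
      · rintro rfl
        simp [Pat]
    simp [this, G_zero]
  · rw [F_eq k n hk S hS, G_succ, ← Fin.sum_univ_eq_sum_range
      (fun i => (-1 : ℚ) ^ i * (B k (i + 1) S).card), mul_sum]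
    refine sum_congr rfl fun i _ => ?_
    have hi := i.2
    have hle : (i + 1 : ℕ) * k ≤ (n + 1) * k := Nat.mul_le_mul_right k hi
    have hsub : (n + 1) * k - (i + 1 : ℕ) * k = (n - i) * k := by
      rw [← Nat.sub_mul]; congr 1; omega
    rw [B_card k _ hk S (by omega)]
    push_cast
    rw [sum_congr rfl (g := fun _ => (((n - i) * k).factorial : ℚ) * G k (n - i))]
    · rw [sum_const, card_powersetCard, hS, nsmul_eq_mul]
      have := Nat.choose_mul_factorial_mul_factorial hle
      rw [hsub] at this
      rw [← this]
      have h0 : (((i + 1 : ℕ) * k).factorial : ℚ) ≠ 0 := by positivity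
      push_cast at h0 ⊢
      field_simp
    · intro T hT
      rw [mem_powersetCard] at hT
      refine ih (n - i) (by omega) _ ?_
      rw [card_sdiff_of_subset hT.1, hS, hT.2, hsub]

lemma fkn_eq (k n : ℕ) : fkn k n = (F k (univ : Finset (Fin (k * n)))).card := by
  classical
  rw [fkn, ← Nat.card_eq_finsetCard]
  have hmem : ∀ w : Equiv.Perm (Fin (k * n)), List.ofFn w ∈ F k univ ↔ DescIffMult k w := by
    intro w
    have h1 : (List.ofFn w).Nodup := List.nodup_ofFn.2 w.injective
    have h2 : (List.ofFn w).toFinset = univ := by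
      ext x
      simp only [List.mem_toFinset, List.mem_ofFn, mem_univ, iff_true]
      exact w.surjective x
    simp only [F, mem_filter, mem_L, h1, h2]
    simp [Pat, DescIffMult]
  refine Nat.card_eq_of_bijective
    (fun w => ⟨List.ofFn w.1, (hmem w.1).2 w.2⟩) ⟨?_, ?_⟩
  · rintro ⟨w, hw⟩ ⟨v, hv⟩ h
    simp only [Subtype.mk.injEq] at h
    have := List.ofFn_injective h
    exact Subtype.ext (DFunLike.coe_injective this)
  · rintro ⟨l, hl⟩
    have hl' := (mem_filter.1 hl).1
    have hlen : l.length = k * n := by simpa using length_L hl'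
    have hn := (mem_L.1 hl').1
    have hinj : Function.Injective (fun j : Fin (k * n) => l[j.1]'(by omega)) := by
      intro a b h
      exact Fin.ext ((hn.getElem_inj_iff).1 h)
    let w : Equiv.Perm (Fin (k * n)) := Equiv.ofBijective _ (Finite.injective_iff_bijective.1 hinj)
    have hw : List.ofFn w = l := by
      apply List.ext_getElem
      · simp [hlen]
      · intro j h1 h2
        simp [w]
    refine ⟨⟨w, (hmem w).1 (hw ▸ hl)⟩, Subtype.ext hw⟩

end FknAux

theorem fkn_inclusion_exclusion (k n : ℕ) (hk : 1 ≤ k) (hn : 1 ≤ n) :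
    (fkn k n : ℚ) =
      ∑ c : Composition n,
        (-1 : ℚ) ^ (n - c.length) *
          ((k * n).factorial : ℚ) / ((c.blocks.map fun i => ((i * k).factorial : ℚ)).prod) := by
  rw [FknAux.fkn_eq, FknAux.main k hk n _ (by simp [mul_comm]), FknAux.G, Finset.mul_sum]
  refine Finset.sum_congr rfl fun c _ => ?_
  rw [FknAux.wt, mul_comm n k]
  ring
end

section
/- For all k, n ≥ 1, f_k(n) = (kn)! · det[ 1/(k(j−i+1))! ]_{i,j=1}^{n}, where the (i,j) entry of the n×n matrix is 1/(k(j−i+1))! and by convention 1/(−m)! = 0 for m > 0. -/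
/-- The `(i,j)` entry `1/(k(j-i+1))!` (indices 1-based, here `i j : Fin n` are 0-based;
`j - i + 1` is the same in both conventions), with the convention `1/(-m)! = 0` for `m > 0`. -/
noncomputable def detEntry (k n : ℕ) (i j : Fin n) : ℚ :=
  if (i : ℕ) ≤ (j : ℕ) + 1 then (1 : ℚ) / ((k * ((j : ℕ) + 1 - (i : ℕ))).factorial : ℚ) else 0


lemma hess_det (h g : ℕ → ℚ) (h0 : h 0 = 1) (g0 : g 0 = 1)
    (hg : ∀ n, 1 ≤ n → ∑ s ∈ Finset.range (n+1), (-1 : ℚ)^s * g s * h (n - s) = 0) (m : ℕ) :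
    (Matrix.of (fun i j : Fin (m+1) => if (i:ℕ) ≤ (j:ℕ) + 1 then h ((j:ℕ) + 1 - i) else 0)).det
      = g (m+1) := by
  set M : Matrix (Fin (m+1)) (Fin (m+1)) ℚ :=
    Matrix.of (fun i j : Fin (m+1) => if (i:ℕ) ≤ (j:ℕ) + 1 then h ((j:ℕ) + 1 - i) else 0) with hM
  have key := Matrix.det_updateRow_sum M 0 (fun i => (-1 : ℚ)^(i:ℕ) * g i)
  simp only [Fin.val_zero, pow_zero, g0, mul_one, one_smul] at key
  rw [← key]
  have hrow : (∑ i : Fin (m+1), ((-1 : ℚ)^(i:ℕ) * g i) • M i)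
      = fun j => if j = Fin.last m then (-1)^m * g (m+1) else 0 := by
    funext j
    have e1 : (∑ i : Fin (m+1), ((-1 : ℚ)^(i:ℕ) * g i) • M i) j
      = ∑ s ∈ Finset.range (m+1), if s ≤ (j:ℕ)+1 then (-1 : ℚ)^s * g s * h (j + 1 - s) else 0 := by
      rw [Finset.sum_range, Finset.sum_apply]
      refine Finset.sum_congr rfl fun i _ => ?_
      simp [hM]
    rw [e1]
    have hj := hg (j+1) (by omega)
    split_ifs with hl
    · subst hl
      rw [Finset.sum_range_succ] at hj
      rw [Finset.sum_congr rfl (g := fun s => (-1 : ℚ)^s * g s * h (m + 1 - s))]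
      · simp [h0] at hj ⊢
        rw [pow_succ] at hj
        linarith
      · intro s hs
        simp at hs
        simp [show s ≤ m + 1 by omega]
    · have hlt : (j:ℕ) < m := by
        have := j.2
        rcases lt_or_ge (j:ℕ) m with h | h
        · exact h
        · exact absurd (Fin.ext (by simp; omega)) hl
      rw [← Finset.sum_filter]
      convert hj using 2
      ext s; simp; omega
  rw [hrow, Matrix.det_succ_row_zero, Finset.sum_eq_single (Fin.last m)]
  · have : ((M.updateRow 0 (fun j => if j = Fin.last m then (-1)^m * g (m+1) else 0)).submatrix
        Fin.succ (Fin.last m).succAbove).det = 1 := by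
      rw [Matrix.det_of_isUpperTriangular]
      · apply Finset.prod_eq_one
        intro i _
        simp [hM, Matrix.updateRow_apply, h0]
      · intro i j hij
        simp only [id] at hij
        have : (j:ℕ) < i := hij
        simp [hM, Matrix.updateRow_apply]
        omega
    rw [this]
    simp [← mul_assoc, ← mul_pow]
  · intro j _ hj
    simp [hj]
  · simp

open Equiv in
noncomputable def glue (a b : ℕ) (x : {s : Finset (Fin (a+b)) // s.card = a} × Perm (Fin a) × Perm (Fin b)) :
    Perm (Fin (a+b)) :=
  finSumFinEquiv.symm.trans ((Equiv.sumCongr x.2.1 x.2.2).trans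
    (finSumEquivOfFinset x.1.2 (by rw [Finset.card_compl, x.1.2]; simp)))

lemma glue_left (a b : ℕ) (x) (i : Fin a) :
    glue a b x (Fin.castAdd b i) = x.1.1.orderEmbOfFin x.1.2 (x.2.1 i) := by
  simp [glue]

lemma glue_right (a b : ℕ) (x) (i : Fin b) :
    glue a b x (Fin.natAdd a i) = x.1.1ᶜ.orderEmbOfFin
      (by rw [Finset.card_compl, x.1.2]; simp) (x.2.2 i) := by
  simp [glue]

lemma glue_inj (a b : ℕ) : Function.Injective (glue a b) := by
  intro x y hxy
  have hs : ∀ x, x.1.1 = Finset.univ.image (fun i => glue a b x (Fin.castAdd b i)) := by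
    intro x
    ext z
    simp only [glue_left, Finset.mem_image, Finset.mem_univ, true_and]
    have := Finset.range_orderEmbOfFin x.1.1 x.1.2
    constructor
    · intro hz
      have hz' : z ∈ Set.range (x.1.1.orderEmbOfFin x.1.2) := by rw [this]; exact hz
      obtain ⟨i, rfl⟩ := hz'
      exact ⟨x.2.1.symm i, by simp⟩
    · rintro ⟨i, rfl⟩
      exact Finset.orderEmbOfFin_mem _ _ _
  have h1 : x.1 = y.1 := Subtype.ext (by rw [hs x, hs y, hxy])
  obtain ⟨s, σ, τ⟩ := x
  obtain ⟨s', σ', τ'⟩ := y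
  simp only at h1
  subst h1
  have h2 : σ = σ' := by
    ext i
    have := glue_left a b (s, σ, τ) i
    rw [hxy, glue_left] at this
    simpa using congrArg Fin.val ((Finset.orderEmbOfFin _ _).injective this).symm
  have h3 : τ = τ' := by
    ext i
    have := glue_right a b (s, σ, τ) i
    rw [hxy, glue_right] at this
    simpa using congrArg Fin.val ((Finset.orderEmbOfFin _ _).injective this).symm
  rw [h2, h3]

lemma glue_bij (a b : ℕ) : Function.Bijective (glue a b) := by
  rw [Fintype.bijective_iff_injective_and_card]
  refine ⟨glue_inj a b, ?_⟩
  simp only [Fintype.card_prod, Fintype.card_perm, Fintype.card_fin, Fintype.card_finset_len]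
  rw [← mul_assoc, Nat.choose_symm_add]
  exact Nat.add_choose_mul_factorial_mul_factorial a b

lemma glue_count (a b : ℕ) (P : Equiv.Perm (Fin a) → Prop) (Q : Equiv.Perm (Fin (a+b)) → Prop)
    (hQ : ∀ x, Q (glue a b x) ↔ P x.2.1 ∧ x.2.2 = 1) :
    Nat.card {w // Q w} = (a+b).choose a * Nat.card {σ // P σ} := by
  have e : ({s : Finset (Fin (a+b)) // s.card = a} × {σ // P σ}) ≃ {w // Q w} := by
    refine Equiv.ofBijective (fun x => ⟨glue a b (x.1, x.2.1, 1), (hQ _).2 ⟨x.2.2, rfl⟩⟩) ⟨?_, ?_⟩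
    · rintro ⟨s, σ⟩ ⟨s', σ'⟩ h
      have := glue_inj a b (congrArg Subtype.val h)
      simp only [Prod.mk.injEq] at this
      exact Prod.ext this.1 (Subtype.ext this.2.1)
    · rintro ⟨w, hw⟩
      obtain ⟨⟨s, σ, τ⟩, rfl⟩ := (glue_bij a b).2 w
      obtain ⟨h1, h2⟩ := (hQ _).1 hw
      simp only at h1 h2
      subst h2
      exact ⟨(s, ⟨σ, h1⟩), rfl⟩
  rw [← Nat.card_congr e, Nat.card_prod]
  congr 1
  rw [Nat.card_eq_fintype_card, Fintype.card_finset_len, Fintype.card_fin]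

lemma perm_eq_one_of_asc (b : ℕ) (τ : Equiv.Perm (Fin b))
    (h : ∀ j : ℕ, ∀ hj : j + 1 < b, τ ⟨j, Nat.lt_of_succ_lt hj⟩ < τ ⟨j+1, hj⟩) : τ = 1 := by
  have hm : StrictMono τ := by
    have : ∀ i : ℕ, ∀ d : ℕ, ∀ hd : i + d + 1 < b, τ ⟨i, by omega⟩ < τ ⟨i+d+1, hd⟩ := by
      intro i d
      induction d with
      | zero => intro hd; exact h i hd
      | succ d ih => intro hd; exact (ih (by omega)).trans (h (i+d+1) hd)
    intro i j hij
    have hij' : (i:ℕ) < j := hij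
    have := this i (j - i - 1) (by omega)
    have e : (⟨(i:ℕ) + (j - i - 1) + 1, by omega⟩ : Fin b) = j := Fin.ext (by simp; omega)
    rwa [e] at this
  have : (OrderIso.refl (Fin b)) = (hm.orderIsoOfSurjective _ τ.surjective) := Subsingleton.elim _ _
  ext i
  have := congrArg (fun e => ((e i : Fin b) : ℕ)) this
  simpa using this.symm

/-- Descents free at `a`, prescribed before, ascending after. -/
def XPat (k a : ℕ) {m : ℕ} (w : Equiv.Perm (Fin m)) : Prop :=
  ∀ j : ℕ, ∀ h : j + 1 < m,
    (j + 1 < a → (w ⟨j + 1, h⟩ < w ⟨j, Nat.lt_of_succ_lt h⟩ ↔ k ∣ (j + 1))) ∧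
    (a < j + 1 → ¬ (w ⟨j + 1, h⟩ < w ⟨j, Nat.lt_of_succ_lt h⟩))

def EPat (k a : ℕ) {m : ℕ} (w : Equiv.Perm (Fin m)) : Prop :=
  ∀ j : ℕ, ∀ h : j + 1 < m,
    (w ⟨j + 1, h⟩ < w ⟨j, Nat.lt_of_succ_lt h⟩ ↔ k ∣ (j + 1) ∧ j + 1 ≤ a)

lemma X_count (k a b : ℕ) : Nat.card {w : Equiv.Perm (Fin (a+b)) // XPat k a w}
    = (a+b).choose a * Nat.card {w : Equiv.Perm (Fin a) // DescIffMult k w} := by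
  apply glue_count
  intro x
  have hl : ∀ j (hj : j < a) , glue a b x ⟨j, by omega⟩ = x.1.1.orderEmbOfFin x.1.2 (x.2.1 ⟨j, hj⟩) :=
    fun j hj => glue_left a b x ⟨j, hj⟩
  have hr : ∀ j (hj : j < b) , glue a b x ⟨a + j, by omega⟩ = x.1.1ᶜ.orderEmbOfFin
      (by rw [Finset.card_compl, x.1.2]; simp) (x.2.2 ⟨j, hj⟩) :=
    fun j hj => glue_right a b x ⟨j, hj⟩
  constructor
  · intro hX
    constructor
    · intro j hj
      have := (hX j (by omega)).1 hj
      rwa [hl _ hj, hl j (by omega), OrderEmbedding.lt_iff_lt] at this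
    · apply perm_eq_one_of_asc
      intro j hj
      have := (hX (a + j) (by omega)).2 (by omega)
      have h2 := hr (j+1) hj
      simp only [← add_assoc] at h2
      rw [h2, hr j (by omega), OrderEmbedding.lt_iff_lt, not_lt] at this
      refine lt_of_le_of_ne this fun h => ?_
      have := x.2.2.injective h
      simp at this
  · rintro ⟨h1, h2⟩ j hj
    constructor
    · intro hja
      have := h1 j hja
      rwa [hl _ hja, hl j (by omega), OrderEmbedding.lt_iff_lt]
    · intro hja
      obtain ⟨d, rfl⟩ : ∃ d, j = a + d := ⟨j - a, by omega⟩
      have h3 := hr (d+1) (by omega)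
      simp only [← add_assoc] at h3
      rw [h3, hr d (by omega), OrderEmbedding.lt_iff_lt, h2]
      simp [Fin.lt_def]

lemma X_count' (k t n : ℕ) (ht : t ≤ n) :
    Nat.card {w : Equiv.Perm (Fin (k*n)) // XPat k (k*t) w} = (k*n).choose (k*t) * fkn k t := by
  obtain ⟨b, hb⟩ := Nat.exists_eq_add_of_le (Nat.mul_le_mul_left k ht)
  rw [hb]
  exact X_count k (k*t) b

lemma E_zero (k n : ℕ) :
    Nat.card {w : Equiv.Perm (Fin (k*n)) // EPat k (k*0) w} = (k*n).choose (k*0) * fkn k 0 := by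
  rw [← X_count' k 0 n (by omega)]
  refine Nat.card_congr (Equiv.subtypeEquivRight fun w => ?_)
  simp [XPat, EPat]

lemma E_top (k n : ℕ) :
    Nat.card {w : Equiv.Perm (Fin (k*n)) // EPat k (k*n) w} = fkn k n := by
  refine Nat.card_congr (Equiv.subtypeEquivRight fun w => ?_)
  unfold EPat DescIffMult
  refine forall₂_congr fun j hj => ?_
  rw [and_iff_left hj.le]

lemma E_top' (k n : ℕ) :
    Nat.card {w : Equiv.Perm (Fin (k*(n+1))) // EPat k (k*n) w} = fkn k (n+1) := by
  refine Nat.card_congr (Equiv.subtypeEquivRight fun w => ?_)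
  unfold EPat DescIffMult
  refine forall₂_congr fun j hj => ?_
  have : k ∣ j + 1 → j + 1 ≤ k * n := by
    rintro ⟨c, hc⟩
    rw [hc] at hj ⊢
    have := Nat.lt_of_mul_lt_mul_left hj
    exact Nat.mul_le_mul_left k (by omega)
  rw [and_iff_left_of_imp this]

lemma E_step (k t n : ℕ) (hk : 1 ≤ k) (ht : t + 1 < n) :
    Nat.card {w : Equiv.Perm (Fin (k*n)) // EPat k (k*(t+1)) w} +
    Nat.card {w : Equiv.Perm (Fin (k*n)) // EPat k (k*t) w}
     = (k*n).choose (k*(t+1)) * fkn k (t+1) := by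
  classical
  rw [← X_count' k (t+1) n (by omega)]
  have hlt : k * (t+1) < k * n := Nat.mul_lt_mul_of_pos_left ht hk
  have hpos : 0 < k * (t+1) := by positivity
  have hkt : k * (t+1) = k * t + k := by ring
  have hb : ∀ j, j < k*(t+1) → k ∣ j → j ≤ k * t := by
    rintro j h ⟨c, rfl⟩
    have := Nat.lt_of_mul_lt_mul_left h
    exact Nat.mul_le_mul_left k (by omega)
  obtain ⟨p, hp⟩ : ∃ p, k * (t+1) = p + 1 := ⟨k * (t+1) - 1, by omega⟩
  have hpn : p + 1 < k * n := by omega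
  have hdvd : k ∣ p + 1 := hp ▸ Dvd.intro _ rfl
  have hdisj : Disjoint (fun w : Equiv.Perm (Fin (k*n)) => EPat k (k*(t+1)) w)
      (fun w => EPat k (k*t) w) := by
    rw [Pi.disjoint_iff]
    intro w
    rw [Prop.disjoint_iff]
    by_contra hc
    have h1 := (hc.1 p hpn).2 ⟨hdvd, by omega⟩
    have h2 := (hc.2 p hpn).1 h1
    omega
  rw [Nat.card_eq_fintype_card, Nat.card_eq_fintype_card, Nat.card_eq_fintype_card,
    ← Fintype.card_subtype_or_disjoint _ _ hdisj]
  refine Fintype.card_congr (Equiv.subtypeEquivRight fun w => ?_)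
  constructor
  · rintro (h | h) j hj
    · refine ⟨fun hlt => ?_, fun hgt => ?_⟩
      · rw [h j hj, and_iff_left hlt.le]
      · rw [h j hj]; omega
    · refine ⟨fun hlt => ?_, fun hgt => ?_⟩
      · rw [h j hj, and_iff_left_of_imp (hb _ hlt)]
      · rw [h j hj]; omega
  · intro h
    by_cases hd : w ⟨p + 1, hpn⟩ < w ⟨p, Nat.lt_of_succ_lt hpn⟩
    · left
      intro j hj
      rcases lt_trichotomy (j+1) (k*(t+1)) with hl | he | hg
      · rw [(h j hj).1 hl, and_iff_left hl.le]
      · obtain rfl : j = p := by omega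
        exact iff_of_true hd ⟨hdvd, he.le⟩
      · simp only [(h j hj).2 hg, false_iff]; omega
    · right
      intro j hj
      rcases lt_trichotomy (j+1) (k*(t+1)) with hl | he | hg
      · rw [(h j hj).1 hl, and_iff_left_of_imp (hb _ hl)]
      · obtain rfl : j = p := by omega
        simp only [hd, false_iff]; omega
      · simp only [(h j hj).2 hg, false_iff]; omega

lemma E_sum (k n t : ℕ) (hk : 1 ≤ k) (ht : t < n) :
    (-1 : ℚ)^t * (Nat.card {w : Equiv.Perm (Fin (k*n)) // EPat k (k*t) w} : ℚ)
     = ∑ s ∈ Finset.range (t+1), (-1 : ℚ)^s * ((k*n).choose (k*s) * fkn k s : ℚ) := by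
  induction t with
  | zero => simpa using congrArg (Nat.cast : ℕ → ℚ) (E_zero k n)
  | succ t ih =>
    rw [Finset.sum_range_succ, ← ih (by omega)]
    have := congrArg (Nat.cast : ℕ → ℚ) (E_step k t n hk ht)
    push_cast at this
    rw [← this, pow_succ]
    ring

lemma fkn_zero (k : ℕ) : fkn k 0 = 1 := by
  unfold fkn
  rw [Nat.card_eq_one_iff_unique]
  exact ⟨⟨fun a b => Subtype.ext (Equiv.ext fun i => absurd i.2 (by simp))⟩,
    ⟨⟨1, fun j h => absurd h (by simp)⟩⟩⟩

lemma fkn_rec (k n : ℕ) (hk : 1 ≤ k) (hn : 1 ≤ n) :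
    ∑ s ∈ Finset.range (n+1), (-1 : ℚ)^s * ((fkn k s : ℚ) / ((k*s).factorial : ℚ)) *
      (1 / ((k * (n - s)).factorial : ℚ)) = 0 := by
  obtain ⟨m, rfl⟩ : ∃ m, n = m + 1 := ⟨n - 1, by omega⟩
  have h := E_sum k (m+1) m hk (by omega)
  rw [E_top'] at h
  have hf : ((k*(m+1)).factorial : ℚ) ≠ 0 := by positivity
  have e : ∀ s ∈ Finset.range (m+1+1), (-1 : ℚ)^s * ((fkn k s : ℚ) / ((k*s).factorial : ℚ)) *
      (1 / ((k * (m + 1 - s)).factorial : ℚ)) =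
      ((-1 : ℚ)^s * ((k*(m+1)).choose (k*s) * fkn k s : ℚ)) / ((k*(m+1)).factorial : ℚ) := by
    intro s hs
    have hs' : s ≤ m + 1 := by simp at hs; omega
    rw [Nat.cast_choose ℚ (Nat.mul_le_mul_left k hs'), ← Nat.mul_sub]
    field_simp
  rw [Finset.sum_congr rfl e, ← Finset.sum_div, Finset.sum_range_succ, ← h]
  simp [pow_succ]

theorem fkn_det (k n : ℕ) (hk : 1 ≤ k) (hn : 1 ≤ n) :
    (fkn k n : ℚ) = ((k * n).factorial : ℚ) * (Matrix.of (detEntry k n)).det := by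
  obtain ⟨m, rfl⟩ : ∃ m, n = m + 1 := ⟨n - 1, by omega⟩
  have h := hess_det (fun r => 1 / ((k * r).factorial : ℚ))
    (fun s => (fkn k s : ℚ) / ((k*s).factorial : ℚ)) (by simp) (by simp [fkn_zero])
    (fun n hn => fkn_rec k n hk hn) m
  have e : (Matrix.of (detEntry k (m+1))).det = (fkn k (m+1) : ℚ) / ((k*(m+1)).factorial : ℚ) := h
  rw [e]
  field_simp
end

section
/- For all n ≥ 1, E_{2n−1} = (2n−1)! · det[ 1/c_{ij}! ]_{i,j=1}^{n}, where c_{1,j} = 2j−1 for 1 ≤ j ≤ n, c_{ij} = 2(j−i+1) for 2 ≤ i ≤ n and 1 ≤ j ≤ n, and by convention 1/(−m)! = 0 for m > 0. -/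
/-- The `(i,j)` entry `1/c_{ij}!`, where (1-indexed) `c_{1,j} = 2j-1` and
`c_{i,j} = 2(j-i+1)` for `i ≥ 2`; here `i j : Fin n` are 0-indexed, and the
convention `1/(-m)! = 0` for `m > 0` is used. -/
noncomputable def oddDetEntry (n : ℕ) (i j : Fin n) : ℚ :=
  if (i : ℕ) = 0 then (1 : ℚ) / ((2 * (j : ℕ) + 1).factorial : ℚ)
  else if (i : ℕ) ≤ (j : ℕ) + 1 then (1 : ℚ) / ((2 * ((j : ℕ) + 1 - (i : ℕ))).factorial : ℚ)
  else 0

namespace EulerDet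

/-- The alternation condition at position `j`. -/
def AltAt {n : ℕ} (w : Equiv.Perm (Fin n)) (j : ℕ) (h : j + 1 < n) : Prop :=
  (Even j → w ⟨j + 1, h⟩ < w ⟨j, Nat.lt_of_succ_lt h⟩) ∧
    (¬ Even j → w ⟨j, Nat.lt_of_succ_lt h⟩ < w ⟨j + 1, h⟩)

/-- First `k` entries alternate, remaining entries increase. -/
def BSet (N k : ℕ) : Set (Equiv.Perm (Fin N)) :=
  {w | ∀ j : ℕ, ∀ h : j + 1 < N, (j + 1 < k → AltAt w j h) ∧
    (k ≤ j → w ⟨j, Nat.lt_of_succ_lt h⟩ < w ⟨j + 1, h⟩)}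

/-- First `k` entries alternate, and entries from the `k`-th on increase. -/
def PSet (N k : ℕ) : Set (Equiv.Perm (Fin N)) :=
  {w | ∀ j : ℕ, ∀ h : j + 1 < N, (j + 1 < k → AltAt w j h) ∧
    (k ≤ j + 1 → w ⟨j, Nat.lt_of_succ_lt h⟩ < w ⟨j + 1, h⟩)}

lemma BSet_eq (N l : ℕ) (h : 2 * l + 3 ≤ N) :
    BSet N (2 * l + 1) = PSet N (2 * l + 1) ∪ PSet N (2 * (l + 1) + 1) := by
  ext w
  constructor
  · intro hw
    have h0 : 2 * l + 1 < N := by omega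
    rcases lt_trichotomy (w ⟨2 * l, by omega⟩) (w ⟨2 * l + 1, h0⟩) with hlt | heq | hgt
    · left
      intro j hj
      refine ⟨(hw j hj).1, fun hk => ?_⟩
      rcases Nat.lt_or_ge j (2 * l + 1) with h1 | h1
      · obtain rfl : j = 2 * l := by omega
        exact hlt
      · exact (hw j hj).2 h1
    · have := w.injective heq
      simp at this
    · right
      intro j hj
      refine ⟨fun hk => ?_, fun hk => (hw j hj).2 (by omega)⟩
      rcases Nat.lt_or_ge (j + 1) (2 * l + 1) with h1 | h1
      · exact (hw j hj).1 h1
      · rcases Nat.lt_or_ge j (2 * l + 1) with h2 | h2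
        · obtain rfl : j = 2 * l := by omega
          exact ⟨fun _ => hgt, fun h => absurd (even_two_mul l) h⟩
        · obtain rfl : j = 2 * l + 1 := by omega
          refine ⟨fun h => ?_, fun _ => (hw _ hj).2 le_rfl⟩
          exact absurd h (by simp)
  · rintro (hw | hw)
    · intro j hj
      exact ⟨(hw j hj).1, fun hk => (hw j hj).2 (by omega)⟩
    · intro j hj
      refine ⟨fun hk => (hw j hj).1 (by omega), fun hk => ?_⟩
      rcases Nat.lt_or_ge j (2 * l + 2) with h1 | h1
      · obtain rfl : j = 2 * l + 1 := by omega
        exact ((hw _ hj).1 (by omega)).2 (by simp)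
      · exact (hw j hj).2 (by omega)

lemma PSet_disj (N l : ℕ) (h : 2 * l + 3 ≤ N) :
    Disjoint (PSet N (2 * l + 1)) (PSet N (2 * (l + 1) + 1)) := by
  rw [Set.disjoint_left]
  intro w h1 h2
  have a := (h1 (2 * l) (by omega)).2 le_rfl
  have b := ((h2 (2 * l) (by omega)).1 (by omega)).1 (even_two_mul l)
  exact lt_asymm a b

lemma card_BSet_eq (N l : ℕ) (h : 2 * l + 3 ≤ N) :
    (BSet N (2 * l + 1)).ncard
      = (PSet N (2 * l + 1)).ncard + (PSet N (2 * (l + 1) + 1)).ncard := by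
  rw [BSet_eq N l h, Set.ncard_union_eq (PSet_disj N l h)]

lemma PSet_top (N : ℕ) : PSet N N = BSet N N := by
  ext w
  constructor
  · intro hw j hj
    exact ⟨(hw j hj).1, fun hk => by omega⟩
  · intro hw j hj
    exact ⟨(hw j hj).1, fun hk => by omega⟩

lemma PSet_one (N : ℕ) : (PSet N 1).ncard = 1 := by
  rw [Set.ncard_eq_one]
  refine ⟨1, ?_⟩
  ext w
  simp only [Set.mem_singleton_iff]
  constructor
  · intro hw
    have hm : StrictMono w := by
      cases N with
      | zero => exact fun a => a.elim0
      | succ N =>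
        rw [Fin.strictMono_iff_lt_succ]
        intro i
        exact (hw i (by omega)).2 (by omega)
    have := Subsingleton.elim (hm.orderIsoOfSurjective w w.surjective) (OrderIso.refl _)
    ext i
    have := congrArg (fun f : Fin N ≃o Fin N => (f i : ℕ)) this
    simpa using this
  · rintro rfl j hj
    refine ⟨fun h => by omega, fun _ => ?_⟩
    simp [Fin.lt_def]

/-- The permutation glued from a subset and a permutation. -/
noncomputable def glue {k m : ℕ} (S : Finset (Fin (k + m))) (hS : S.card = k)
    (σ : Equiv.Perm (Fin k)) : Equiv.Perm (Fin (k + m)) :=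
  finSumFinEquiv.symm.trans ((Equiv.sumCongr σ (Equiv.refl (Fin m))).trans
    (finSumEquivOfFinset hS (by rw [Finset.card_compl, hS]; simp)))

lemma compl_card {k m : ℕ} {S : Finset (Fin (k + m))} (hS : S.card = k) : Sᶜ.card = m := by
  rw [Finset.card_compl, hS]; simp

lemma glue_left {k m : ℕ} (S : Finset (Fin (k + m))) (hS : S.card = k)
    (σ : Equiv.Perm (Fin k)) (i : ℕ) (hi : i < k) (hi' : i < k + m) :
    glue S hS σ ⟨i, hi'⟩ = S.orderEmbOfFin hS (σ ⟨i, hi⟩) := by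
  have : (⟨i, hi'⟩ : Fin (k + m)) = Fin.castAdd m ⟨i, hi⟩ := rfl
  rw [this, glue, Equiv.trans_apply, finSumFinEquiv_symm_apply_castAdd]
  simp

lemma glue_right {k m : ℕ} (S : Finset (Fin (k + m))) (hS : S.card = k)
    (σ : Equiv.Perm (Fin k)) (i : ℕ) (hi : i < m) (hi' : k + i < k + m) :
    glue S hS σ ⟨k + i, hi'⟩ = Sᶜ.orderEmbOfFin (compl_card hS) ⟨i, hi⟩ := by
  have : (⟨k + i, hi'⟩ : Fin (k + m)) = Fin.natAdd k ⟨i, hi⟩ := rfl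
  rw [this, glue, Equiv.trans_apply, finSumFinEquiv_symm_apply_natAdd]
  simp

lemma glue_mem {k m : ℕ} (S : Finset (Fin (k + m))) (hS : S.card = k)
    (σ : Equiv.Perm (Fin k)) : glue S hS σ ∈ BSet (k + m) k ↔ IsAltPerm σ := by
  constructor
  · intro hw j hj
    have := (hw j (by omega)).1 hj
    unfold AltAt at this
    rw [glue_left S hS σ j (by omega), glue_left S hS σ (j + 1) (by omega)] at this
    simpa using this
  · intro hσ j hj
    constructor
    · intro hk
      unfold AltAt
      rw [glue_left S hS σ j (by omega), glue_left S hS σ (j + 1) (by omega)]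
      simpa using hσ j hk
    · intro hk
      obtain ⟨i, rfl⟩ := Nat.exists_eq_add_of_le hk
      rw [glue_right S hS σ i (by omega)]
      have := glue_right S hS σ (i + 1) (by omega) hj
      change _ < glue S hS σ ⟨k + (i + 1), hj⟩
      rw [this]
      simp

lemma glue_image {k m : ℕ} (S : Finset (Fin (k + m))) (hS : S.card = k)
    (σ : Equiv.Perm (Fin k)) :
    Finset.univ.image (fun i : Fin k => glue S hS σ (Fin.castAdd m i)) = S := by
  apply Finset.eq_of_subset_of_card_le
  · intro x hx
    simp only [Finset.mem_image, Finset.mem_univ, true_and] at hx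
    obtain ⟨i, rfl⟩ := hx
    have := glue_left S hS σ i i.2 (by omega)
    change glue S hS σ ⟨i, by omega⟩ ∈ S
    rw [this]
    exact Finset.orderEmbOfFin_mem _ _ _
  · rw [Finset.card_image_of_injective, hS]
    · simp
    · exact (glue S hS σ).injective.comp (Fin.castAdd_injective k m)

lemma card_BSet (k m : ℕ) :
    (BSet (k + m) k).ncard = (k + m).choose k * eulerNumber k := by
  classical
  have h1 : Nat.card {S : Finset (Fin (k + m)) // S.card = k} = (k + m).choose k := by
    rw [Nat.card_eq_fintype_card, Fintype.card_finset_len, Fintype.card_fin]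
  rw [← h1, eulerNumber, ← Nat.card_prod, ← Nat.card_coe_set_eq]
  symm
  refine Nat.card_eq_of_bijective
    (fun p => ⟨glue p.1.1 p.1.2 p.2.1, (glue_mem _ _ _).2 p.2.2⟩) ⟨?_, ?_⟩
  · rintro ⟨⟨S, hS⟩, ⟨σ, hσ⟩⟩ ⟨⟨S', hS'⟩, ⟨σ', hσ'⟩⟩ h
    have h : glue S hS σ = glue S' hS' σ' := congrArg Subtype.val h
    have e : S = S' := by
      rw [← glue_image S hS σ, ← glue_image S' hS' σ', h]
    subst e
    have : σ = σ' := by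
      ext1 i
      have := congrArg (fun w : Equiv.Perm (Fin (k + m)) => w ⟨i, by omega⟩) h
      rw [glue_left S hS σ i i.2, glue_left S hS σ' i i.2] at this
      exact (S.orderEmbOfFin hS).injective this
    subst this
    rfl
  · rintro ⟨w, hw⟩
    let S := Finset.univ.image (fun i : Fin k => w (Fin.castAdd m i))
    have hinj : Function.Injective (fun i : Fin k => w (Fin.castAdd m i)) :=
      w.injective.comp (Fin.castAdd_injective k m)
    have hS : S.card = k := by
      rw [Finset.card_image_of_injective _ hinj]; simp
    have hmem : ∀ i : Fin k, w (Fin.castAdd m i) ∈ S := fun i =>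
      Finset.mem_image_of_mem _ (Finset.mem_univ i)
    let f : Fin k → Fin k := fun i => (S.orderIsoOfFin hS).symm ⟨_, hmem i⟩
    have hf : Function.Injective f := by
      intro a b hab
      have := (S.orderIsoOfFin hS).symm.injective hab
      exact hinj (congrArg Subtype.val this)
    let σ : Equiv.Perm (Fin k) := Equiv.ofBijective f (Finite.injective_iff_bijective.1 hf)
    have key : glue S hS σ = w := by
      have hr : (fun i : Fin m => w (Fin.natAdd k i)) = Sᶜ.orderEmbOfFin (compl_card hS) := by
        apply Finset.orderEmbOfFin_unique
        · intro i
          simp only [S, Finset.mem_compl, Finset.mem_image, Finset.mem_univ, true_and, not_exists]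
          intro j hj
          have := congrArg Fin.val (w.injective hj)
          simp at this
          omega
        · cases m with
          | zero => exact fun a => a.elim0
          | succ m =>
            rw [Fin.strictMono_iff_lt_succ]
            intro i
            exact (hw (k + i) (by omega)).2 (by omega)
      ext1 i
      refine Fin.addCases (fun i => ?_) (fun i => ?_) i
      · refine (glue_left S hS σ i i.2 (by omega)).trans ?_
        change S.orderEmbOfFin hS (f i) = _
        rw [← Finset.coe_orderIsoOfFin_apply]
        simp [f]
      · refine (glue_right S hS σ i i.2 (by omega)).trans ?_
        rw [← hr]
    refine ⟨⟨⟨S, hS⟩, ⟨σ, ?_⟩⟩, ?_⟩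
    · rw [← glue_mem S hS σ, key]; exact hw
    · exact Subtype.ext key

lemma tele (N l : ℕ) (h : 2 * l + 1 ≤ N) :
    ∑ i ∈ Finset.range l, (-1 : ℚ) ^ i * ((BSet N (2 * i + 1)).ncard : ℚ)
      = 1 - (-1) ^ l * ((PSet N (2 * l + 1)).ncard : ℚ) := by
  induction l with
  | zero => simp [PSet_one]
  | succ l ih =>
    rw [Finset.sum_range_succ, ih (by omega), card_BSet_eq N l (by omega)]
    push_cast
    ring

/-- Tangent coefficients. -/
noncomputable def T (i : ℕ) : ℚ := (eulerNumber (2 * i + 1) : ℚ) / ((2 * i + 1).factorial : ℚ)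

lemma T_rec (j : ℕ) :
    ∑ i ∈ Finset.range (j + 1), (-1 : ℚ) ^ i * T i * (1 / ((2 * (j - i)).factorial : ℚ))
      = 1 / ((2 * j + 1).factorial : ℚ) := by
  have h := tele (2 * j + 1) j le_rfl
  rw [PSet_top] at h
  have h2 : ∑ i ∈ Finset.range (j + 1),
      (-1 : ℚ) ^ i * ((BSet (2 * j + 1) (2 * i + 1)).ncard : ℚ) = 1 := by
    rw [Finset.sum_range_succ, h]; ring
  have hne : ((2 * j + 1).factorial : ℚ) ≠ 0 := by positivity
  rw [eq_div_iff hne, Finset.sum_mul]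
  refine Eq.trans ?_ h2
  refine Finset.sum_congr rfl fun i hi => ?_
  have hi' : i ≤ j := by simpa [Nat.lt_succ_iff] using hi
  obtain ⟨d, rfl⟩ := Nat.exists_eq_add_of_le hi'
  have e : 2 * (i + d) + 1 = (2 * i + 1) + 2 * d := by ring
  rw [e, card_BSet]
  have hc : (((2 * i + 1) + 2 * d).choose (2 * i + 1) : ℚ) * ((2 * i + 1).factorial : ℚ)
      * ((2 * d).factorial : ℚ) = (((2 * i + 1) + 2 * d).factorial : ℚ) := by
    have := Nat.choose_mul_factorial_mul_factorial (Nat.le_add_right (2 * i + 1) (2 * d))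
    rw [Nat.add_sub_cancel_left] at this
    exact_mod_cast this
  rw [← hc, T]
  have h1 : ((2 * i + 1).factorial : ℚ) ≠ 0 := by positivity
  have h2 : ((2 * d).factorial : ℚ) ≠ 0 := by positivity
  simp only [Nat.add_sub_cancel_left]
  push_cast
  field_simp

/-- Row-combination coefficients. -/
noncomputable def cf (i : ℕ) : ℚ := if i = 0 then 1 else - ((-1) ^ (i - 1) * T (i - 1))

lemma row_sum (m : ℕ) (j : Fin (m + 1)) :
    ∑ i : Fin (m + 1), cf i * oddDetEntry (m + 1) i j
      = if j = Fin.last m then (-1) ^ m * T m else 0 := by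
  rw [Fin.sum_univ_succ]
  have h1 : ∀ i : Fin m, cf (i.succ : Fin (m + 1)) * oddDetEntry (m + 1) i.succ j
      = - (if (i : ℕ) ≤ j then
        (-1 : ℚ) ^ (i : ℕ) * T i * (1 / ((2 * ((j : ℕ) - i)).factorial : ℚ)) else 0) := by
    intro i
    simp only [cf, oddDetEntry, Fin.val_succ, Nat.add_sub_cancel, Nat.add_le_add_iff_right,
      Nat.add_sub_add_right, Nat.succ_ne_zero, if_false]
    split_ifs <;> ring
  simp only [h1]
  rw [Fin.sum_univ_eq_sum_range (fun i => - (if i ≤ (j : ℕ) then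
        (-1 : ℚ) ^ i * T i * (1 / ((2 * ((j : ℕ) - i)).factorial : ℚ)) else 0)) m,
    Finset.sum_neg_distrib, ← Finset.sum_filter]
  have h0 : cf ((0 : Fin (m + 1)) : ℕ) * oddDetEntry (m + 1) 0 j
      = 1 / ((2 * (j : ℕ) + 1).factorial : ℚ) := by
    simp [cf, oddDetEntry]
  rw [h0, ← T_rec]
  split_ifs with hj
  · subst hj
    have : (Finset.range m).filter (fun i => i ≤ ((Fin.last m : Fin (m + 1)) : ℕ))
        = Finset.range m := by
      ext i; simp; omega
    rw [this]
    simp [Finset.sum_range_succ]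
  · have hj' : (j : ℕ) < m := by
      have := Fin.val_ne_of_ne hj
      simp at this
      omega
    have : (Finset.range m).filter (fun i => i ≤ (j : ℕ)) = Finset.range (j + 1) := by
      ext i; simp; omega
    rw [this]
    ring

lemma det_eq (m : ℕ) : (Matrix.of (oddDetEntry (m + 1))).det = T m := by
  have h := Matrix.det_updateRow_sum (Matrix.of (oddDetEntry (m + 1))) 0 (fun i => cf i)
  have hc : cf ((0 : Fin (m + 1)) : ℕ) = 1 := by simp [cf]
  simp only [hc, one_smul] at h
  rw [← h, Matrix.det_succ_row_zero, Finset.sum_eq_single (Fin.last m)]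
  · have hr : (∑ k : Fin (m + 1), cf k • (Matrix.of (oddDetEntry (m + 1))) k) (Fin.last m)
        = (-1) ^ m * T m := by
      have := row_sum m (Fin.last m)
      simpa [Finset.sum_apply] using this
    rw [Matrix.updateRow_self, hr, Matrix.det_of_isUpperTriangular]
    · have : ∀ i : Fin m, ((Matrix.of (oddDetEntry (m + 1))).updateRow 0
          (∑ k : Fin (m + 1), cf k • (Matrix.of (oddDetEntry (m + 1))) k)).submatrix
          Fin.succ (Fin.last m).succAbove i i = 1 := by
        intro i
        simp [Matrix.updateRow_apply, oddDetEntry]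
      simp only [this]
      simp [← mul_assoc, ← mul_pow]
    · intro i j hij
      have hij : j < i := hij
      have : ¬ ((i : ℕ) ≤ j) := by simpa using hij
      simp [Matrix.updateRow_apply, oddDetEntry, this]
  · intro j _ hj
    have hr : (∑ k : Fin (m + 1), cf k • (Matrix.of (oddDetEntry (m + 1))) k) j = 0 := by
      have := row_sum m j
      rw [if_neg hj] at this
      simpa [Finset.sum_apply] using this
    rw [Matrix.updateRow_self, hr]
    simp
  · simp

end EulerDet

theorem euler_odd_det (n : ℕ) (hn : 1 ≤ n) :
    (eulerNumber (2 * n - 1) : ℚ) =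
      ((2 * n - 1).factorial : ℚ) * (Matrix.of (oddDetEntry n)).det := by
  obtain ⟨m, rfl⟩ := Nat.exists_eq_add_of_le' hn
  rw [EulerDet.det_eq, EulerDet.T]
  have e : 2 * (m + 1) - 1 = 2 * m + 1 := by omega
  rw [e]
  have h1 : ((2 * m + 1).factorial : ℚ) ≠ 0 := by positivity
  field_simp
end

section
/- In the ring of formal power series in x over the field ℚ(q) of rational functions, cos_q(x) · Σ_{n≥0} E_n(q) x^n/[n]! = 1 + sin_q(x); that is, Σ_{n≥0} E_n(q) x^n/[n]! = 1/cos_q(x) + sin_q(x)/cos_q(x). -/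
/-- Reverse alternating: `a_1 < a_2 > a_3 < ⋯` (0-indexed: position `j` even ⇒ ascent). -/
def IsRevAltPerm {n : ℕ} (w : Equiv.Perm (Fin n)) : Prop :=
  ∀ j : ℕ, ∀ h : j + 1 < n,
    (Even j → w ⟨j, Nat.lt_of_succ_lt h⟩ < w ⟨j + 1, h⟩) ∧
    (¬ Even j → w ⟨j + 1, h⟩ < w ⟨j, Nat.lt_of_succ_lt h⟩)

/-- The number of inversions of a permutation. -/
def invCount {n : ℕ} (w : Equiv.Perm (Fin n)) : ℕ :=
  ((Finset.univ : Finset (Fin n × Fin n)).filter fun p => p.1 < p.2 ∧ w p.2 < w p.1).card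

open scoped Classical in
/-- The inversion `q`-analogue `E_n(q) = Σ_{w reverse alternating} q^{inv w}`,
as an element of the field `ℚ(q)` of rational functions. -/
noncomputable def EnQ (n : ℕ) : RatFunc ℚ :=
  ∑ w : Equiv.Perm (Fin n), if IsRevAltPerm w then (RatFunc.X : RatFunc ℚ) ^ invCount w else 0

/-- `[m]! = (1-q)(1-q²)⋯(1-qᵐ)`. -/
noncomputable def qFact (m : ℕ) : RatFunc ℚ :=
  ∏ i ∈ Finset.range m, (1 - (RatFunc.X : RatFunc ℚ) ^ (i + 1))

/-- `cos_q(x) = Σ (-1)^n x^{2n}/[2n]!` as a formal power series over `ℚ(q)`. -/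
noncomputable def qCos : PowerSeries (RatFunc ℚ) :=
  PowerSeries.mk fun m => if Even m then ((-1 : RatFunc ℚ) ^ (m / 2)) / qFact m else 0

/-- `sin_q(x) = Σ (-1)^n x^{2n+1}/[2n+1]!` as a formal power series over `ℚ(q)`. -/
noncomputable def qSin : PowerSeries (RatFunc ℚ) :=
  PowerSeries.mk fun m => if ¬ Even m then ((-1 : RatFunc ℚ) ^ (m / 2)) / qFact m else 0

namespace QE

abbrev K := RatFunc ℚ
noncomputable abbrev q : K := RatFunc.X

/-! ### Algebra -/

theorem one_sub_ne (i : ℕ) : (1 - q ^ (i + 1) : K) ≠ 0 := by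
  intro h
  have h1 : (q ^ (i + 1) : K) = 1 := (sub_eq_zero.mp h).symm
  have h2 : algebraMap (Polynomial ℚ) K (Polynomial.X ^ (i + 1)) = algebraMap (Polynomial ℚ) K 1 := by
    rw [map_pow, RatFunc.algebraMap_X, map_one]; exact h1
  have h3 := RatFunc.algebraMap_injective ℚ h2
  have h4 := congrArg Polynomial.natDegree h3
  simp at h4

theorem qFact_ne (m : ℕ) : qFact m ≠ 0 :=
  Finset.prod_ne_zero_iff.mpr fun i _ => one_sub_ne i

theorem qFact_zero : qFact 0 = 1 := by simp [qFact]

theorem qFact_succ (m : ℕ) : qFact (m + 1) = qFact m * (1 - q ^ (m + 1)) := by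
  simp [qFact, Finset.prod_range_succ]

noncomputable def qb : ℕ → ℕ → K
  | _, 0 => 1
  | 0, _ + 1 => 0
  | m + 1, j + 1 => qb m j + q ^ (j + 1) * qb m (j + 1)

theorem qb_zero (m : ℕ) : qb m 0 = 1 := by cases m <;> rfl

theorem qb_lt : ∀ (m j : ℕ), m < j → qb m j = 0
  | _, 0, h => by omega
  | 0, _ + 1, _ => rfl
  | m + 1, j + 1, h => by
    rw [qb, qb_lt m j (by omega), qb_lt m (j + 1) (by omega)]; ring

theorem qb_fact : ∀ (s a b : ℕ), a + b = s → qb s a * (qFact a * qFact b) = qFact s := by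
  intro s
  induction s with
  | zero =>
    intro a b h
    obtain ⟨rfl, rfl⟩ : a = 0 ∧ b = 0 := by omega
    simp [qb_zero, qFact_zero]
  | succ s ih =>
    intro a b h
    rcases a with _ | a
    · obtain rfl : b = s + 1 := by omega
      simp [qb_zero, qFact_zero]
    · rcases b with _ | b
      · obtain rfl : a = s := by omega
        have := ih a 0 (by omega)
        rw [qb, qb_lt a (a + 1) (by omega), qFact_succ]
        linear_combination (1 - q ^ (a + 1)) * this
      · have h1 := ih a (b + 1) (by omega)
        have h2 := ih (a + 1) b (by omega)
        rw [qb]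
        have e : q ^ (s + 1) = q ^ (a + 1) * q ^ (b + 1) := by
          rw [← pow_add]; congr 1; omega
        rw [qFact_succ s, e]
        rw [qFact_succ b] at h1 ⊢
        rw [qFact_succ a] at h2 ⊢
        linear_combination (1 - q ^ (a + 1)) * h1 + q ^ (a + 1) * (1 - q ^ (b + 1)) * h2

/-- iterated up-operator, starting from a function `f` on `range m`. -/
noncomputable def itU (m : ℕ) (f : ℕ → K) : ℕ → ℕ → K
  | 0, p => f p
  | j + 1, p => q ^ p * ∑ x ∈ Finset.Ico p (m + j), itU m f j x

noncomputable def tot (m : ℕ) (f : ℕ → K) : K := ∑ p ∈ Finset.range m, f p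

noncomputable def up (m : ℕ) (f : ℕ → K) (p : ℕ) : K := q ^ p * ∑ x ∈ Finset.Ico p m, f x
noncomputable def dn (f : ℕ → K) (p : ℕ) : K := q ^ p * ∑ x ∈ Finset.range p, f x

theorem itU_congr (m : ℕ) (f g : ℕ → K) (h : ∀ p < m, f p = g p) (j p : ℕ) (hp : p < m + j) :
    itU m f j p = itU m g j p := by
  induction j generalizing p with
  | zero => exact h p hp
  | succ j ih =>
    simp only [itU]
    congr 1
    refine Finset.sum_congr rfl fun x hx => ih x (Finset.mem_Ico.mp hx).2

theorem itU_up (m : ℕ) (f : ℕ → K) (j p : ℕ) :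
    itU (m + 1) (up m f) j p = itU m f (j + 1) p := by
  induction j generalizing p with
  | zero => rfl
  | succ j ih =>
    rw [itU]
    simp only [ih]
    rw [itU, show m + 1 + j = m + (j + 1) by ring]

theorem itU_sub (m : ℕ) (f g : ℕ → K) (j p : ℕ) :
    itU m (fun p => f p - g p) j p = itU m f j p - itU m g j p := by
  induction j generalizing p with
  | zero => rfl
  | succ j ih => simp only [itU, ih, Finset.sum_sub_distrib, mul_sub]

theorem itU_J (n : ℕ) (c : K) (i : ℕ) : ∀ (d p : ℕ), p + d = n + 1 + i →
    ∑ x ∈ Finset.Ico p (n + 1 + i), itU (n + 1) (fun p => q ^ p * c) i x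
      = c * (q ^ ((i + 1) * p) * qb d (i + 1)) := by
  induction i with
  | zero =>
    intro d
    induction d with
    | zero => intro p hp; rw [show p = n + 1 + 0 by omega]; simp [qb]
    | succ d ih =>
      intro p hp
      rw [Finset.sum_eq_sum_Ico_succ_bot (by omega), ih (p + 1) (by omega)]
      simp only [itU, qb, qb_zero]
      ring
  | succ i ihi =>
    intro d
    induction d with
    | zero => intro p hp; rw [show p = n + 1 + (i + 1) by omega]; simp [qb]
    | succ d ih =>
      intro p hp
      rw [Finset.sum_eq_sum_Ico_succ_bot (by omega), ih (p + 1) (by omega)]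
      rw [itU, ihi d p (by omega), qb]
      ring

theorem tot_J (n : ℕ) (c : K) (i : ℕ) :
    tot (n + 1 + i) (itU (n + 1) (fun p => q ^ p * c) i) = c * qb (n + 1 + i) (i + 1) := by
  have := itU_J n c i (n + 1 + i) 0 (by omega)
  rw [tot, Finset.range_eq_Ico, this]; simp

theorem step (m j : ℕ) (f : ℕ → K) :
    tot (m + 2 + j) (itU (m + 2) (up (m + 1) (dn f)) j)
      = tot m f * qb (m + 2 + j) (j + 2) - tot (m + (j + 2)) (itU m f (j + 2)) := by
  have h1 : ∀ p < m + 1, dn f p = q ^ p * tot m f - up m f p := by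
    intro p hp
    rw [dn, up, tot, ← Finset.sum_range_add_sum_Ico f (show p ≤ m by omega)]
    ring
  have h2 : ∀ p ∈ Finset.range (m + 2 + j), itU (m + 2) (up (m + 1) (dn f)) j p =
      itU (m + 1) (fun p => q ^ p * tot m f) (j + 1) p - itU m f (j + 2) p := by
    intro p hp
    rw [Finset.mem_range] at hp
    rw [itU_up, itU_congr (m + 1) _ _ h1 (j + 1) p (by omega), itU_sub, itU_up]
  have h3 := tot_J m (tot m f) (j + 1)
  rw [show m + 1 + (j + 1) = m + 2 + j by ring] at h3
  rw [← h3]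
  simp only [tot]
  rw [Finset.sum_congr rfl h2, Finset.sum_sub_distrib, show m + (j + 2) = m + 2 + j by ring]
  rfl

/-! ### Combinatorics -/

def Cond (b : ℕ) {n : ℕ} (w : Equiv.Perm (Fin n)) : Prop :=
  ∀ j : ℕ, ∀ h : j + 1 < n,
    (Even (j + b) → w ⟨j, Nat.lt_of_succ_lt h⟩ < w ⟨j + 1, h⟩) ∧
    (¬ Even (j + b) → w ⟨j + 1, h⟩ < w ⟨j, Nat.lt_of_succ_lt h⟩)

theorem ins_bij {n : ℕ} (p : Fin (n + 1)) (e : Equiv.Perm (Fin n)) :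
    Function.Bijective (Fin.cons p (fun i => p.succAbove (e i)) : Fin (n + 1) → Fin (n + 1)) := by
  rw [← Finite.injective_iff_bijective, Fin.cons_injective_iff]
  refine ⟨?_, fun a b h => e.injective (Fin.succAbove_right_injective h)⟩
  rintro ⟨i, hi⟩
  exact Fin.succAbove_ne _ _ hi

noncomputable def ins {n : ℕ} (p : Fin (n + 1)) (e : Equiv.Perm (Fin n)) :
    Equiv.Perm (Fin (n + 1)) := Equiv.ofBijective _ (ins_bij p e)

theorem ins_zero {n : ℕ} (p : Fin (n + 1)) (e : Equiv.Perm (Fin n)) : ins p e 0 = p := rfl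
theorem ins_succ {n : ℕ} (p : Fin (n + 1)) (e : Equiv.Perm (Fin n)) (i : Fin n) :
    ins p e i.succ = p.succAbove (e i) := rfl

theorem ins_pair_bij (n : ℕ) : Function.Bijective
    (fun x : Fin (n + 1) × Equiv.Perm (Fin n) => ins x.1 x.2) := by
  rw [Fintype.bijective_iff_injective_and_card]
  constructor
  · rintro ⟨p, e⟩ ⟨p', e'⟩ h
    simp only at h
    have h0 : p = p' := by rw [← ins_zero p e, h, ins_zero]
    subst h0
    congr 1
    ext i
    have := congrArg (fun w : Equiv.Perm (Fin (n + 1)) => w i.succ) h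
    simp only [ins_succ] at this
    rw [Fin.succAbove_right_injective this]
  · simp [Fintype.card_perm, Nat.factorial_succ]

theorem invCount_eq {n : ℕ} (w : Equiv.Perm (Fin n)) :
    invCount w = ∑ i, ∑ j, if i < j ∧ w j < w i then 1 else 0 := by
  rw [invCount, Finset.card_filter, Fintype.sum_prod_type]

theorem inv_ins {n : ℕ} (p : Fin (n + 1)) (e : Equiv.Perm (Fin n)) :
    invCount (ins p e) = p + invCount e := by
  rw [invCount_eq, invCount_eq, Fin.sum_univ_succ]
  congr 1
  · rw [Fin.sum_univ_succ]
    simp only [ins_zero, ins_succ, lt_irrefl, false_and, if_false, zero_add, Fin.succ_pos, true_and]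
    rw [Equiv.sum_comp e (fun k => if p.succAbove k < p then 1 else 0)]
    simp only [Fin.succAbove_lt_iff_castSucc_lt]
    have h0 : ∀ x : Fin n, (x.castSucc < p) = ((x : ℕ) < (p : ℕ)) := fun _ => rfl
    simp only [h0]
    rw [Fin.sum_univ_eq_sum_range (fun k => if k < (p : ℕ) then 1 else 0) n, ← Finset.card_filter]
    have : (Finset.range n).filter (fun k => k < (p : ℕ)) = Finset.range p := by
      ext k; simp; omega
    rw [this, Finset.card_range]
  · refine Finset.sum_congr rfl fun i _ => ?_
    rw [Fin.sum_univ_succ]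
    simp [ins_succ, ins_zero]

theorem cond_ins {n : ℕ} (b : ℕ) (p : Fin (n + 2)) (e : Equiv.Perm (Fin (n + 1))) :
    Cond b (ins p e) ↔ Cond (b + 1) e ∧
      (if Even b then (p : ℕ) ≤ (e 0 : ℕ) else (e 0 : ℕ) < p) := by
  have h0 : ins p e ⟨0, by omega⟩ = p := rfl
  have hs : ∀ (j : ℕ) (h : j + 1 < n + 2), ins p e ⟨j + 1, h⟩ = p.succAbove (e ⟨j, by omega⟩) :=
    fun _ _ => rfl
  constructor
  · intro H
    constructor
    · intro j hj
      have := H (j + 1) (by omega)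
      rw [hs, hs, Fin.succAbove_lt_succAbove_iff, Fin.succAbove_lt_succAbove_iff,
        show j + 1 + b = j + (b + 1) by ring] at this
      exact this
    · have := H 0 (by omega)
      rw [h0, hs, Fin.succAbove_lt_iff_castSucc_lt, Fin.lt_succAbove_iff_le_castSucc, zero_add] at this
      split_ifs with hb
      · exact this.1 hb
      · exact this.2 hb
  · rintro ⟨H, H0⟩ j hj
    rcases j with _ | j
    · rw [h0, hs, Fin.succAbove_lt_iff_castSucc_lt, Fin.lt_succAbove_iff_le_castSucc, zero_add]
      split_ifs at H0 with hb
      · exact ⟨fun _ => H0, fun h => absurd hb h⟩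
      · exact ⟨fun h => absurd h hb, fun _ => H0⟩
    · rw [hs, hs, Fin.succAbove_lt_succAbove_iff, Fin.succAbove_lt_succAbove_iff,
        show j + 1 + b = j + (b + 1) by ring]
      exact H j (by omega)

open scoped Classical in
noncomputable def S (b n p : ℕ) : K :=
  ∑ w : Equiv.Perm (Fin (n + 1)), if Cond b w ∧ (w 0 : ℕ) = p then q ^ invCount w else 0

open scoped Classical in
theorem S_sum (b n : ℕ) (s : Finset ℕ) : ∑ p ∈ s, S b n p =
    ∑ w : Equiv.Perm (Fin (n + 1)), if Cond b w ∧ (w 0 : ℕ) ∈ s then q ^ invCount w else 0 := by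
  simp only [S]
  rw [Finset.sum_comm]
  refine Finset.sum_congr rfl fun w _ => ?_
  by_cases h : Cond b w <;> simp [h]

open scoped Classical in
theorem S_rec (b n p : ℕ) (hp : p < n + 2) : S b (n + 1) p =
    q ^ p * ∑ x ∈ (if Even b then Finset.Ico p (n + 1) else Finset.range p), S (b + 1) n x := by
  rw [S_sum, S, ← (ins_pair_bij (n + 1)).sum_comp, Fintype.sum_prod_type,
    Finset.sum_eq_single (⟨p, hp⟩ : Fin (n + 2)), Finset.mul_sum]
  · refine Finset.sum_congr rfl fun e _ => ?_
    simp only [cond_ins, ins_zero, inv_ins, and_true, mul_ite, mul_zero, pow_add]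
    have he := (e 0).isLt
    have hm : (if Even b then p ≤ (e 0 : ℕ) else (e 0 : ℕ) < p) ↔
        (e 0 : ℕ) ∈ (if Even b then Finset.Ico p (n + 1) else Finset.range p) := by
      split_ifs
      · rw [Finset.mem_Ico]; exact ⟨fun h => ⟨h, he⟩, fun h => h.1⟩
      · rw [Finset.mem_range]
    simp only [hm]
  · intro x _ hx
    refine Finset.sum_eq_zero fun e _ => ?_
    rw [if_neg]
    rintro ⟨_, h⟩
    exact hx (Fin.ext h)
  · simp

theorem S_congr (b n p : ℕ) : S (b + 2) n p = S b n p := by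
  have : ∀ w : Equiv.Perm (Fin (n + 1)), Cond (b + 2) w ↔ Cond b w := by
    intro w
    simp only [Cond, ← add_assoc, Nat.even_add, even_two, iff_true]
  unfold S
  refine Finset.sum_congr rfl fun w _ => ?_
  by_cases hw : Cond b w
  · have hw' := (this w).mpr hw
    simp only [hw, hw', true_and]
  · have hw' : ¬ Cond (b + 2) w := fun h => hw ((this w).mp h)
    simp only [hw, hw', false_and, if_false]

theorem S_up (n p : ℕ) (hp : p < n + 2) : S 0 (n + 1) p = up (n + 1) (S 1 n) p := by
  rw [S_rec _ _ _ hp]; simp [up]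

theorem S_dn (n p : ℕ) (hp : p < n + 2) : S 1 (n + 1) p = dn (S 0 n) p := by
  rw [S_rec _ _ _ hp]; simp [dn, S_congr]

theorem S_base (b : ℕ) : S b 0 0 = 1 := by
  have : ∀ w : Equiv.Perm (Fin 1), Cond b w ∧ (w 0 : ℕ) = 0 := by
    intro w
    refine ⟨fun j hj => by omega, by omega⟩
  have h0 : ∀ w : Equiv.Perm (Fin 1), invCount w = 0 := by
    intro w
    rw [invCount, Finset.card_eq_zero, Finset.filter_eq_empty_iff]
    rintro ⟨x, y⟩ _ ⟨h, _⟩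
    omega
  unfold S
  rw [Finset.sum_congr rfl fun w _ => if_pos (this w)]
  simp [h0]

theorem EnQ_succ (n : ℕ) : EnQ (n + 1) = tot (n + 1) (S 0 n) := by
  rw [tot, S_sum, EnQ]
  refine Finset.sum_congr rfl fun w _ => ?_
  have : IsRevAltPerm w ↔ Cond 0 w ∧ (w 0 : ℕ) ∈ Finset.range (n + 1) := by
    refine ⟨fun h => ⟨h, Finset.mem_range.mpr (w 0).isLt⟩, fun h => h.1⟩
  by_cases hw : IsRevAltPerm w
  · rw [if_pos hw, if_pos (this.mp hw)]
  · rw [if_neg hw, if_neg fun h => hw (this.mpr h)]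

theorem EnQ_zero : EnQ 0 = 1 := by
  have : ∀ w : Equiv.Perm (Fin 0), IsRevAltPerm w := fun w j hj => by omega
  simp [EnQ, this, invCount]

/-! ### Assembling -/

/-- `h j n` is the total weight of `U^j R_{n+1}`. -/
noncomputable def h (j n : ℕ) : K := tot (n + 1 + j) (itU (n + 1) (S 0 n) j)

theorem tot_congr (m : ℕ) (f g : ℕ → K) (h : ∀ p < m, f p = g p) : tot m f = tot m g :=
  Finset.sum_congr rfl fun p hp => h p (Finset.mem_range.mp hp)

theorem h_zero (n : ℕ) : h 0 n = EnQ (n + 1) := by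
  rw [EnQ_succ]; rfl

theorem h_rec (j n : ℕ) : h j (n + 2) = EnQ (n + 1) * qb (n + 3 + j) (j + 2) - h (j + 2) n := by
  rw [EnQ_succ, h, h, ← step (n + 1) j (S 0 n)]
  refine tot_congr _ _ _ fun p hp => itU_congr _ _ _ (fun p hp => ?_) _ _ hp
  rw [S_up _ _ hp, up, up]
  congr 1
  refine Finset.sum_congr rfl fun x hx => S_dn _ _ (Finset.mem_Ico.mp hx).2

theorem h_base (b j : ℕ) : tot (0 + 1 + j) (itU (0 + 1) (S b 0) j) = 1 := by
  have h1 := tot_J 0 1 j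
  have h2 := qb_fact (0 + 1 + j) (j + 1) 0 (by omega)
  rw [qFact_zero, mul_one, show 0 + 1 + j = j + 1 by ring] at h2
  have h3 : qb (j + 1) (j + 1) = 1 := by
    have := qFact_ne (j + 1)
    exact mul_right_cancel₀ this (by rw [h2, one_mul])
  rw [show 0 + 1 + j = j + 1 by ring] at h1 ⊢
  rw [h3, mul_one] at h1
  rw [← h1]
  refine tot_congr _ _ _ fun p hp => itU_congr _ _ _ (fun p hp => ?_) _ _ (by omega)
  obtain rfl : p = 0 := by omega
  rw [S_base]; simp

theorem h_0 (j : ℕ) : h j 0 = 1 := h_base 0 j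

theorem h_1 (j : ℕ) : h j 1 = 1 := by
  rw [h, ← h_base 1 (j + 1), show 1 + 1 + j = 0 + 1 + (j + 1) by ring]
  refine tot_congr _ _ _ fun p hp => ?_
  rw [← itU_up]
  exact itU_congr _ _ _ (fun p hp => S_up _ _ hp) _ _ (by omega)

noncomputable def c (n : ℕ) : K := EnQ n / qFact n

noncomputable def P (j n : ℕ) : K :=
  ∑ a ∈ Finset.range (n + 1), (if Even a then (-1 : K) ^ (a / 2) / qFact (j + a) else 0) * c (n - a)

theorem P_rec (j n : ℕ) : P j (n + 2) = c (n + 2) / qFact j - P (j + 2) n := by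
  rw [P, Finset.sum_range_succ', Finset.sum_range_succ', P, sub_eq_add_neg, ← Finset.sum_neg_distrib]
  have : ∀ a ∈ Finset.range (n + 1),
      (if Even (a + 1 + 1) then (-1 : K) ^ ((a + 1 + 1) / 2) / qFact (j + (a + 1 + 1)) else 0)
        * c (n + 2 - (a + 1 + 1)) =
      -((if Even a then (-1 : K) ^ (a / 2) / qFact (j + 2 + a) else 0) * c (n - a)) := by
    intro a _
    rw [show a + 1 + 1 = a + 2 by ring, show (a + 2) / 2 = a / 2 + 1 by omega,
      show j + (a + 2) = j + 2 + a by ring, show n + 2 - (a + 2) = n - a by omega]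
    simp only [Nat.even_add, even_two, iff_true]
    split_ifs <;> ring
  rw [Finset.sum_congr rfl this]
  simp
  ring

noncomputable def eps (n : ℕ) : K := if ¬ Even n then (-1 : K) ^ (n / 2) else 0

theorem eps_rec (n : ℕ) : eps (n + 2) = - eps n := by
  simp only [eps, Nat.even_add, even_two, iff_true, show (n + 2) / 2 = n / 2 + 1 by omega]
  split_ifs <;> ring

theorem c_0 : c 0 = 1 := by simp [c, EnQ_zero, qFact_zero]

theorem main : ∀ (n j : ℕ), h j n / qFact (n + 1 + j) =
    c (n + 1) / qFact j - P j (n + 1) + eps (n + 1) / qFact (n + 1 + j)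
  | 0, j => by
    rw [h_0]
    simp [P, eps, Finset.sum_range_succ]
    ring
  | 1, j => by
    rw [h_1, P_rec]
    simp [P, eps, c_0, add_comm]
  | n + 2, j => by
    have ih := main n (j + 2)
    have h1 := qb_fact (n + 3 + j) (j + 2) (n + 1) (by omega)
    have e : n + 1 + (j + 2) = n + 3 + j := by ring
    rw [e] at ih
    have h2 : EnQ (n + 1) * qb (n + 3 + j) (j + 2) / qFact (n + 3 + j)
        = c (n + 1) / qFact (j + 2) := by
      have a1 := qFact_ne (n + 1)
      have a2 := qFact_ne (j + 2)
      have a3 := qFact_ne (n + 3 + j)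
      rw [c, div_div, div_eq_div_iff a3 (mul_ne_zero a1 a2), ← h1]
      ring
    rw [show n + 2 + 1 + j = n + 3 + j by ring, show n + 2 + 1 = n + 1 + 2 by ring, h_rec, P_rec,
      eps_rec, sub_div, h2, ih]
    ring

theorem P_zero (n : ℕ) : P 0 (n + 1) = eps (n + 1) / qFact (n + 1) := by
  have := main n 0
  rw [h_zero, qFact_zero] at this
  simp only [add_zero, div_one] at this
  rw [← c] at this
  linear_combination this

theorem gf1 : qCos * PowerSeries.mk (fun n => EnQ n / qFact n) = 1 + qSin := by
  ext n
  rw [PowerSeries.coeff_mul, Finset.Nat.sum_antidiagonal_eq_sum_range_succ_mk, map_add]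
  simp only [qCos, qSin, PowerSeries.coeff_mk, PowerSeries.coeff_one]
  have hP : ∑ k ∈ Finset.range n.succ,
      (if Even k then (-1 : K) ^ (k / 2) / qFact k else 0) * (EnQ (n - k) / qFact (n - k)) = P 0 n := by
    simp only [P, c, zero_add]
  rw [hP]
  rcases n with _ | n
  · simp [P, c_0, qFact_zero]
  · rw [P_zero, eps]
    split_ifs <;> simp_all

theorem cos_const : PowerSeries.constantCoeff qCos ≠ 0 := by
  rw [← PowerSeries.coeff_zero_eq_constantCoeff_apply]
  simp [qCos, qFact_zero]

end QE

theorem qEuler_gf :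
    qCos * PowerSeries.mk (fun n => EnQ n / qFact n) = 1 + qSin ∧
    PowerSeries.mk (fun n => EnQ n / qFact n) = qCos⁻¹ + qSin * qCos⁻¹ := by
  refine ⟨QE.gf1, ?_⟩
  rw [← one_add_mul, PowerSeries.eq_mul_inv_iff_mul_eq QE.cos_const, mul_comm]
  exact QE.gf1
end

section
/- For every n ≥ 1, the n-dimensional Lebesgue volume of the zigzag order polytope P_n = { x ∈ ℝ^n : 0 ≤ x_i ≤ 1 for all i, and x_i ≥ x_{i+1} for i odd, x_i ≤ x_{i+1} for i even (1 ≤ i ≤ n−1) } equals E_n/n!. -/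
open MeasureTheory

/-- The zigzag order polytope: `0 ≤ x_i ≤ 1` and (1-indexed) `x_i ≥ x_{i+1}` for `i` odd,
`x_i ≤ x_{i+1}` for `i` even; here positions are 0-indexed, so position `j` even
corresponds to 1-indexed `i = j+1` odd. -/
def zigzagOrderPolytope (n : ℕ) : Set (Fin n → ℝ) :=
  {x | (∀ i : Fin n, 0 ≤ x i ∧ x i ≤ 1) ∧
    ∀ j : ℕ, ∀ h : j + 1 < n,
      (Even j → x ⟨j + 1, h⟩ ≤ x ⟨j, Nat.lt_of_succ_lt h⟩) ∧
      (¬ Even j → x ⟨j, Nat.lt_of_succ_lt h⟩ ≤ x ⟨j + 1, h⟩)}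

def orderRegion {n : ℕ} (w : Equiv.Perm (Fin n)) : Set (Fin n → ℝ) :=
  {x | ∀ i j, x i < x j ↔ w i < w j}

lemma measurableSet_orderRegion {n : ℕ} (w : Equiv.Perm (Fin n)) :
    MeasurableSet (orderRegion w) := by
  have : orderRegion w = ⋂ i, ⋂ j, {x : Fin n → ℝ | x i < x j ↔ w i < w j} := by
    ext x; simp [orderRegion]
  rw [this]
  refine MeasurableSet.iInter fun i => MeasurableSet.iInter fun j => ?_
  have hm : MeasurableSet {x : Fin n → ℝ | x i < x j} :=
    measurableSet_lt (measurable_pi_apply i) (measurable_pi_apply j)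
  by_cases h : w i < w j
  · simpa [h] using hm
  · simpa [h, Set.compl_def] using hm.compl

lemma orderRegion_unique {n : ℕ} {w v : Equiv.Perm (Fin n)} {x : Fin n → ℝ}
    (hw : x ∈ orderRegion w) (hv : x ∈ orderRegion v) : w = v := by
  have h : ∀ i j, w i < w j ↔ v i < v j := fun i j => (hw i j).symm.trans (hv i j)
  have hs : StrictMono (fun i => v (w.symm i)) := by
    intro i j hij
    apply (h _ _).1
    simpa using hij
  have hsurj : Function.Surjective (fun i => v (w.symm i)) :=
    v.surjective.comp w.symm.surjective
  have he : (StrictMono.orderIsoOfSurjective _ hs hsurj) = OrderIso.refl (Fin n) :=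
    Subsingleton.elim _ _
  ext i
  have := congrArg (fun e : Fin n ≃o Fin n => e (w i)) he
  simp at this
  rw [this]

lemma exists_orderRegion {n : ℕ} {x : Fin n → ℝ} (hx : Function.Injective x) :
    ∃ w, x ∈ orderRegion w := by
  refine ⟨(Tuple.sort x).symm, fun i j => ?_⟩
  have hs : StrictMono (x ∘ Tuple.sort x) :=
    (Tuple.monotone_sort x).strictMono_of_injective (hx.comp (Tuple.sort x).injective)
  have := hs.lt_iff_lt (a := (Tuple.sort x).symm i) (b := (Tuple.sort x).symm j)
  simpa using this

lemma volume_coord_eq {n : ℕ} {i j : Fin n} (hij : i ≠ j) :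
    volume {x : Fin n → ℝ | x i = x j} = 0 := by
  let L : (Fin n → ℝ) →ₗ[ℝ] ℝ := LinearMap.proj (R := ℝ) (φ := fun _ : Fin n => ℝ) i -
    LinearMap.proj (R := ℝ) (φ := fun _ : Fin n => ℝ) j
  have h := Measure.addHaar_submodule (volume : Measure (Fin n → ℝ)) (LinearMap.ker L) (by
    intro ht
    have : (Pi.single i 1 : Fin n → ℝ) ∈ LinearMap.ker L := by rw [ht]; trivial
    simp [L, hij.symm] at this)
  convert h using 2
  ext x
  simp [L, sub_eq_zero]

lemma ae_injective (n : ℕ) : ∀ᵐ x : Fin n → ℝ, Function.Injective x := by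
  have : ∀ i j : Fin n, i ≠ j → ∀ᵐ x : Fin n → ℝ, x i ≠ x j := by
    intro i j hij
    rw [ae_iff]
    simpa using volume_coord_eq hij
  have h2 : ∀ᵐ x : Fin n → ℝ, ∀ i j : Fin n, i ≠ j → x i ≠ x j := by
    rw [ae_all_iff]; intro i
    rw [ae_all_iff]; intro j
    by_cases hij : i = j
    · simp [hij]
    · filter_upwards [this i j hij] with x hx _ using hx
  filter_upwards [h2] with x hx i j h
  by_contra hne
  exact hx i j hne h

lemma volume_decomp {n : ℕ} (A : Set (Fin n → ℝ)) (hA : MeasurableSet A) :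
    volume A = ∑ w : Equiv.Perm (Fin n), volume (A ∩ orderRegion w) := by
  have h1 : volume A = volume (⋃ w : Equiv.Perm (Fin n), A ∩ orderRegion w) := by
    apply measure_congr
    filter_upwards [ae_injective n] with x hx
    obtain ⟨w, hw⟩ := exists_orderRegion hx
    apply propext
    change x ∈ A ↔ x ∈ ⋃ w : Equiv.Perm (Fin n), A ∩ orderRegion w
    simp only [Set.mem_iUnion, Set.mem_inter_iff]
    exact ⟨fun h => ⟨w, h, hw⟩, fun ⟨_, h, _⟩ => h⟩
  rw [h1, measure_iUnion _ fun w => hA.inter (measurableSet_orderRegion w), tsum_fintype]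
  intro w v hwv
  refine Set.disjoint_left.2 fun x hx hx' => hwv (orderRegion_unique hx.2 hx'.2)

def unitCube (n : ℕ) : Set (Fin n → ℝ) := Set.pi Set.univ fun _ => Set.Icc 0 1

lemma measurableSet_unitCube (n : ℕ) : MeasurableSet (unitCube n) :=
  MeasurableSet.univ_pi fun _ => measurableSet_Icc

lemma volume_unitCube (n : ℕ) : volume (unitCube n) = 1 := by
  rw [unitCube, volume_pi_pi]; simp

lemma volume_region_eq {n : ℕ} (w : Equiv.Perm (Fin n)) :
    volume (unitCube n ∩ orderRegion w) = volume (unitCube n ∩ orderRegion (1 : Equiv.Perm (Fin n))) := by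
  have hp := volume_measurePreserving_piCongrLeft (fun _ : Fin n => ℝ) w
  refine Eq.trans ?_ (hp.measure_preimage_equiv _)
  congr 1
  ext x
  have hx : ∀ i, (MeasurableEquiv.piCongrLeft (fun _ : Fin n => ℝ) w) x i = x (w.symm i) := by
    intro i
    obtain ⟨k, rfl⟩ := w.surjective i
    rw [MeasurableEquiv.piCongrLeft_apply_apply]; simp
  simp only [Set.mem_inter_iff, Set.mem_preimage, unitCube, orderRegion, Set.mem_pi,
    Set.mem_ofPred_eq, hx, Set.mem_univ, true_imp_iff]
  refine and_congr ?_ ?_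
  · exact ⟨fun h i => h _, fun h i => by simpa using h (w i)⟩
  · exact ⟨fun h i j => by simpa using h (w.symm i) (w.symm j),
      fun h i j => by simpa using h (w i) (w j)⟩

lemma volume_region {n : ℕ} (w : Equiv.Perm (Fin n)) :
    volume (unitCube n ∩ orderRegion w) = ((n.factorial : ℕ) : ENNReal)⁻¹ := by
  have h := volume_decomp (unitCube n) (measurableSet_unitCube n)
  rw [volume_unitCube, Finset.sum_congr rfl (fun v _ => (volume_region_eq v).trans
    (volume_region_eq w).symm), Finset.sum_const, Finset.card_univ, Fintype.card_perm,
    Fintype.card_fin, nsmul_eq_mul] at h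
  exact ENNReal.eq_inv_of_mul_eq_one_left (by rw [mul_comm]; exact h.symm)

lemma measurableSet_zigzag (n : ℕ) : MeasurableSet (zigzagOrderPolytope n) := by
  apply IsClosed.measurableSet
  unfold zigzagOrderPolytope
  simp only [Set.ofPred_and, Set.ofPred_forall]
  refine IsClosed.inter (isClosed_iInter fun i => IsClosed.inter ?_ ?_)
    (isClosed_iInter fun j => isClosed_iInter fun h => IsClosed.inter
      (isClosed_iInter fun _ => ?_) (isClosed_iInter fun _ => ?_)) <;>
  exact isClosed_le (by fun_prop) (by fun_prop)

lemma zigzag_inter_alt {n : ℕ} {w : Equiv.Perm (Fin n)} (hw : IsAltPerm w) :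
    zigzagOrderPolytope n ∩ orderRegion w = unitCube n ∩ orderRegion w := by
  ext x
  constructor
  · rintro ⟨h, h'⟩
    exact ⟨fun i _ => h.1 i, h'⟩
  · rintro ⟨h, h'⟩
    exact ⟨⟨fun i => h i trivial, fun j hj =>
      ⟨fun he => ((h' _ _).2 ((hw j hj).1 he)).le,
       fun he => ((h' _ _).2 ((hw j hj).2 he)).le⟩⟩, h'⟩

lemma zigzag_inter_not_alt {n : ℕ} {w : Equiv.Perm (Fin n)} (hw : ¬ IsAltPerm w) :
    zigzagOrderPolytope n ∩ orderRegion w = ∅ := by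
  refine Set.eq_empty_of_forall_notMem fun x hx => hw ?_
  obtain ⟨h, h'⟩ := hx
  have key : ∀ i j, i ≠ j → x i ≤ x j → w i < w j := by
    intro i j hij hle
    refine lt_of_le_of_ne (not_lt.1 fun hlt => ?_) (fun he => hij (w.injective he))
    exact absurd ((h' _ _).2 hlt) (not_lt.2 hle)
  intro j hj
  exact ⟨fun he => key _ _ (by simp) ((h.2 j hj).1 he),
    fun he => key _ _ (by simp) ((h.2 j hj).2 he)⟩

theorem volume_zigzag_order_polytope (n : ℕ) (hn : 1 ≤ n) :
    volume (zigzagOrderPolytope n) =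
      ENNReal.ofReal ((eulerNumber n : ℝ) / n.factorial) := by
  classical
  have hsum : volume (zigzagOrderPolytope n) =
      ∑ w : Equiv.Perm (Fin n), if IsAltPerm w then ((n.factorial : ℕ) : ENNReal)⁻¹ else 0 := by
    rw [volume_decomp _ (measurableSet_zigzag n)]
    refine Finset.sum_congr rfl fun w _ => ?_
    split_ifs with hw
    · rw [zigzag_inter_alt hw, volume_region]
    · rw [zigzag_inter_not_alt hw, measure_empty]
  have hpos : (0 : ℝ) < n.factorial := by exact_mod_cast n.factorial_pos
  rw [hsum, ← Finset.sum_filter, Finset.sum_const, nsmul_eq_mul, eulerNumber,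
    Nat.card_eq_fintype_card, Fintype.card_subtype, ENNReal.ofReal_div_of_pos hpos,
    ENNReal.ofReal_natCast, ENNReal.ofReal_natCast, div_eq_mul_inv]
end

section
/- For every permutation w of {1,2,…,n} (n ≥ 1), there exists an alternating subsequence of w of maximum length (among all alternating subsequences of w) that contains the value n. -/
/-- `s` is a list of positions `i_1 < i_2 < ⋯ < i_k`, and the corresponding values
`w(i_1), w(i_2), …` alternate, descending first: `w(i_1) > w(i_2) < w(i_3) > ⋯`
(0-indexed: at even positions of `s` a descent follows). -/
def IsAltSubseq {n : ℕ} (w : Equiv.Perm (Fin n)) (s : List (Fin n)) : Prop :=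
  s.Chain' (· < ·) ∧
  ∀ j : ℕ, ∀ h : j + 1 < s.length,
    (Even j → w (s.get ⟨j + 1, h⟩) < w (s.get ⟨j, Nat.lt_of_succ_lt h⟩)) ∧
    (¬ Even j → w (s.get ⟨j, Nat.lt_of_succ_lt h⟩) < w (s.get ⟨j + 1, h⟩))

/-- Alternation with a flag `b`: `b = true` means a descent comes first. -/
def AltAux {n : ℕ} (w : Equiv.Perm (Fin n)) (b : Bool) (s : List (Fin n)) : Prop :=
  s.IsChain (· < ·) ∧
  ∀ j : ℕ, ∀ h : j + 1 < s.length,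
    ((Even j ↔ b = true) → w s[j + 1] < w s[j]) ∧
    (¬ (Even j ↔ b = true) → w s[j] < w s[j + 1])

theorem altAux_true_iff {n : ℕ} (w : Equiv.Perm (Fin n)) (s : List (Fin n)) :
    IsAltSubseq w s ↔ AltAux w true s := by
  unfold IsAltSubseq AltAux
  simp only [iff_true, List.get_eq_getElem]
  exact Iff.rfl

theorem altAux_singleton {n : ℕ} (w : Equiv.Perm (Fin n)) (b : Bool) (x : Fin n) :
    AltAux w b [x] := by
  refine ⟨by simp, ?_⟩
  intro j h
  simp at h

theorem altAux_cons {n : ℕ} (w : Equiv.Perm (Fin n)) (b : Bool) (x y : Fin n)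
    (l : List (Fin n)) :
    AltAux w b (x :: y :: l) ↔ x < y ∧ (b = true → w y < w x) ∧ (b = false → w x < w y) ∧
      AltAux w (!b) (y :: l) := by
  constructor
  · rintro ⟨h1, h2⟩
    rw [List.isChain_cons_cons] at h1
    have h0 := h2 0 (by simp)
    refine ⟨h1.1, fun hb => ?_, fun hb => ?_, h1.2, fun j h => ?_⟩
    · simpa using h0.1 (by simp [hb])
    · simpa using h0.2 (by simp [hb])
    · have := h2 (j + 1) (by simpa using h)
      simp only [List.getElem_cons_succ] at this
      cases b <;> simp_all [Nat.even_add_one]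
  · rintro ⟨h1, h2, h3, h4, h5⟩
    refine ⟨List.isChain_cons_cons.2 ⟨h1, h4⟩, fun j h => ?_⟩
    cases j with
    | zero => cases b <;> simp_all
    | succ j =>
      have := h5 j (by simpa using h)
      simp only [List.getElem_cons_succ]
      cases b <;> simp_all [Nat.even_add_one]

theorem altAux_replace {n : ℕ} (w : Equiv.Perm (Fin n)) (m : Fin n) (hm : ∀ i, w i ≤ w m)
    (x : Fin n) (l : List (Fin n)) (hx : m ≤ x) (h : AltAux w true (x :: l)) :
    AltAux w true (m :: l) := by
  cases l with
  | nil => exact altAux_singleton ..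
  | cons y l =>
    rw [altAux_cons] at h ⊢
    exact ⟨hx.trans_lt h.1, fun _ => (h.2.1 rfl).trans_le (hm x), by simp, h.2.2.2⟩

theorem altAux_main {n : ℕ} (w : Equiv.Perm (Fin n)) (m : Fin n) (hm : ∀ i, w i ≤ w m)
    (l : List (Fin n)) : ∀ x : Fin n, x < m →
    (AltAux w true (x :: l) → ∃ y t, AltAux w true (y :: t) ∧ m ∈ y :: t ∧
      l.length ≤ t.length ∧ x ≤ y ∧ w x ≤ w y) ∧
    (AltAux w false (x :: l) → ∃ t, AltAux w false (x :: t) ∧ m ∈ x :: t ∧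
      l.length ≤ t.length) := by
  induction l with
  | nil =>
    intro x hx
    refine ⟨fun _ => ⟨m, [], altAux_singleton .., by simp, le_rfl, hx.le, hm x⟩,
      fun _ => ⟨[m], ?_, by simp, by simp⟩⟩
    rw [altAux_cons]
    exact ⟨hx, by simp, fun _ => lt_of_le_of_ne (hm x) (fun h => hx.ne (w.injective h)),
      altAux_singleton ..⟩
  | cons y l ih =>
    intro x hx
    constructor
    · intro h
      have h' := h
      rw [altAux_cons] at h'
      obtain ⟨h1, h2, -, h4⟩ := h'
      rcases lt_or_ge y m with hy | hy
      · obtain ⟨t, ht, hmt, hl⟩ := (ih y hy).2 h4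
        refine ⟨x, y :: t, ?_, List.mem_cons_of_mem _ hmt, by simpa using hl, le_rfl, le_rfl⟩
        rw [altAux_cons]
        exact ⟨h1, h2, by simp, ht⟩
      · have hne : m ≠ y := by
          rintro rfl
          exact absurd (h2 rfl) (not_lt.2 (hm x))
        refine ⟨m, y :: l, ?_, by simp, le_rfl, hx.le, hm x⟩
        rw [altAux_cons]
        exact ⟨lt_of_le_of_ne hy hne, fun _ => (h2 rfl).trans_le (hm x), by simp, h4⟩
    · intro h
      rw [altAux_cons] at h
      obtain ⟨h1, -, h3, h4⟩ := h
      rcases lt_or_ge y m with hy | hy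
      · obtain ⟨z, t, ht, hmt, hl, hyz, hw⟩ := (ih y hy).1 h4
        refine ⟨z :: t, ?_, List.mem_cons_of_mem _ hmt, by simpa using hl⟩
        rw [altAux_cons]
        exact ⟨h1.trans_le hyz, by simp, fun _ => (h3 rfl).trans_le hw, ht⟩
      · refine ⟨m :: l, ?_, by simp, by simp⟩
        rw [altAux_cons]
        exact ⟨hx, by simp, fun _ => (h3 rfl).trans_le (hm y), altAux_replace w m hm y l hy h4⟩

theorem altAux_exists {n : ℕ} (w : Equiv.Perm (Fin n)) (m : Fin n) (hm : ∀ i, w i ≤ w m)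
    (s : List (Fin n)) (hs : AltAux w true s) :
    ∃ t, AltAux w true t ∧ m ∈ t ∧ s.length ≤ t.length := by
  cases s with
  | nil => exact ⟨[m], altAux_singleton .., by simp, by simp⟩
  | cons x l =>
    rcases lt_or_ge x m with hx | hx
    · obtain ⟨y, t, h1, h2, h3, -⟩ := (altAux_main w m hm l x hx).1 hs
      exact ⟨y :: t, h1, h2, by simpa using h3⟩
    · exact ⟨m :: l, altAux_replace w m hm x l hx hs, by simp, by simp⟩

theorem altAux_length {n : ℕ} (w : Equiv.Perm (Fin n)) (s : List (Fin n))
    (hs : AltAux w true s) : s.length ≤ n := by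
  have h : s.Nodup := (List.isChain_iff_pairwise.1 hs.1).imp (fun h => ne_of_lt h)
  simpa using h.length_le_card

/-- Every permutation of `{1,…,n}` has a longest alternating subsequence
containing the largest value `n` (the top element of `Fin n`). -/
theorem exists_longest_alt_subseq_containing_max (n : ℕ) (hn : 1 ≤ n)
    (w : Equiv.Perm (Fin n)) :
    ∃ s : List (Fin n), IsAltSubseq w s ∧
      (∀ t : List (Fin n), IsAltSubseq w t → t.length ≤ s.length) ∧
      ∃ i ∈ s, (w i : ℕ) = n - 1 := by
  let m : Fin n := w.symm ⟨n - 1, by omega⟩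
  have hwm : w m = ⟨n - 1, by omega⟩ := w.apply_symm_apply _
  have hm : ∀ i, w i ≤ w m := by
    intro i
    rw [hwm, Fin.le_def]
    have := (w i).isLt
    simp only
    omega
  let S : Set ℕ := {k | ∃ s, AltAux w true s ∧ s.length = k}
  have hne : S.Nonempty := ⟨1, [m], altAux_singleton .., rfl⟩
  have hbd : BddAbove S := by
    refine ⟨n, ?_⟩
    rintro k ⟨s, hs, rfl⟩
    exact altAux_length w s hs
  obtain ⟨s, hs, hlen⟩ := Nat.sSup_mem hne hbd
  obtain ⟨t, ht, hmt, hl⟩ := altAux_exists w m hm s hs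
  refine ⟨t, (altAux_true_iff w t).2 ht, fun u hu => ?_, m, hmt, by rw [hwm]⟩
  have : u.length ≤ sSup S := le_csSup hbd ⟨u, (altAux_true_iff w u).1 hu, rfl⟩
  omega
end

section
/- For all n ≥ 2, the average of as(w) over all permutations w of {1,2,…,n} equals (4n+1)/6; equivalently Σ_{w ∈ S_n} as(w) = (4n+1)·n!/6. -/
/-- `as(w)`: the length of the longest alternating subsequence of `w`. -/
noncomputable def altSubseqLen {n : ℕ} (w : Equiv.Perm (Fin n)) : ℕ :=
  sSup {k : ℕ | ∃ s : List (Fin n), IsAltSubseq w s ∧ s.length = k}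

/-- Length of the greedy alternating subsequence ending at position `i`. -/
def altCnt (f : ℕ → ℕ) : ℕ → ℕ
  | 0 => 1
  | i + 1 => if (Odd (altCnt f i) ↔ f i < f (i + 1)) then altCnt f i else altCnt f i + 1

lemma altCnt_pos (f : ℕ → ℕ) (i : ℕ) : 1 ≤ altCnt f i := by
  induction i with
  | zero => simp [altCnt]
  | succ i ih => rw [altCnt]; split_ifs <;> omega

lemma altCnt_parity (f : ℕ → ℕ) (i : ℕ) : Odd (altCnt f (i + 1)) ↔ f i < f (i + 1) := by
  rw [altCnt]
  split_ifs with h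
  · exact h
  · rw [Nat.odd_add_one]; tauto

lemma altCnt_mono (f : ℕ → ℕ) : Monotone (altCnt f) := by
  refine monotone_nat_of_le_succ fun i => ?_
  conv_rhs => rw [altCnt]
  split_ifs <;> omega

lemma altCnt_const_odd (f : ℕ → ℕ) (i d : ℕ) (h : altCnt f (i + d) = altCnt f i)
    (ho : Odd (altCnt f i)) : f i ≤ f (i + d) := by
  induction d with
  | zero => simp
  | succ d ih =>
    have h1 := altCnt_mono f (show i ≤ i + d by omega)
    have h2 := altCnt_mono f (show i + d ≤ i + (d + 1) by omega)
    have h3 := (altCnt_parity f (i + d)).1 (by rw [← h] at ho; exact ho)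
    have := ih (by omega)
    rw [← add_assoc]; omega

lemma altCnt_const_even (f : ℕ → ℕ) (i d : ℕ) (h : altCnt f (i + d) = altCnt f i)
    (ho : ¬ Odd (altCnt f i)) : f (i + d) ≤ f i := by
  induction d with
  | zero => simp
  | succ d ih =>
    have h1 := altCnt_mono f (show i ≤ i + d by omega)
    have h2 := altCnt_mono f (show i + d ≤ i + (d + 1) by omega)
    have h3 := (altCnt_parity f (i + d)).not.1 (by rw [← h] at ho; exact ho)
    have := ih (by omega)
    rw [← add_assoc]; omega

lemma altCnt_formula (f : ℕ → ℕ) (m : ℕ) :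
    altCnt f (m + 1) = 1 + (if f 0 < f 1 then 0 else 1) +
      ∑ j ∈ Finset.range m, (if (f j < f (j + 1) ↔ f (j + 1) < f (j + 2)) then 0 else 1) := by
  induction m with
  | zero => simp only [altCnt]; simp; split_ifs <;> rfl
  | succ m ih =>
    rw [Finset.sum_range_succ, ← add_assoc, ← ih, altCnt]
    simp only [altCnt_parity]
    split_ifs <;> rfl

/-- A permutation as a function on naturals. -/
def permFun {n : ℕ} (w : Equiv.Perm (Fin n)) (i : ℕ) : ℕ :=
  if h : i < n then (w ⟨i, h⟩ : ℕ) else 0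

lemma permFun_val {n : ℕ} (w : Equiv.Perm (Fin n)) (i : Fin n) : permFun w i = w i := by
  simp [permFun]

lemma alt_singleton {n : ℕ} (w : Equiv.Perm (Fin n)) (a : Fin n) : IsAltSubseq w [a] := by
  refine ⟨by first | exact List.isChain_singleton _ | exact List.isChain_nil, fun j h => ?_⟩
  simp at h

lemma alt_nil {n : ℕ} (w : Equiv.Perm (Fin n)) : IsAltSubseq w [] := by
  refine ⟨by first | exact List.isChain_singleton _ | exact List.isChain_nil, fun j h => ?_⟩
  simp at h

lemma alt_concat {n : ℕ} (w : Equiv.Perm (Fin n)) (s : List (Fin n)) (a b : Fin n) :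
    IsAltSubseq w (s ++ [a] ++ [b]) ↔ IsAltSubseq w (s ++ [a]) ∧ a < b ∧
      (Even s.length → w b < w a) ∧ (¬ Even s.length → w a < w b) := by
  unfold IsAltSubseq
  have hc : List.IsChain (· < ·) (s ++ [a] ++ [b]) ↔ List.IsChain (· < ·) (s ++ [a]) ∧ a < b := by
    rw [List.isChain_append]
    simp
  constructor
  · rintro ⟨h1, h2⟩
    obtain ⟨h3, h4⟩ := hc.1 h1
    refine ⟨⟨h3, fun j h => ?_⟩, h4, ?_⟩
    · have := h2 j (by simp at h ⊢; omega)
      simp only [List.get_eq_getElem] at this ⊢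
      rw [List.getElem_append_left h, List.getElem_append_left (Nat.lt_of_succ_lt h)] at this
      exact this
    · have := h2 s.length (by simp)
      simpa using this
  · rintro ⟨⟨h3, h5⟩, h4, h6⟩
    refine ⟨hc.2 ⟨h3, h4⟩, fun j h => ?_⟩
    by_cases hj : j + 1 < (s ++ [a]).length
    · have := h5 j hj
      simp only [List.get_eq_getElem] at this ⊢
      rw [List.getElem_append_left hj, List.getElem_append_left (Nat.lt_of_succ_lt hj)]
      exact this
    · have : j = s.length := by simp at h hj; omega
      subst this
      simpa using h6

lemma alt_upper {n : ℕ} (w : Equiv.Perm (Fin n)) (s : List (Fin n)) :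
    ∀ i : Fin n, IsAltSubseq w (s ++ [i]) → s.length + 1 ≤ altCnt (permFun w) i := by
  induction s using List.reverseRecOn with
  | nil => intro i _; simpa using altCnt_pos _ _
  | append_singleton s a ih =>
    intro i h
    obtain ⟨h1, h2, h3, h4⟩ := (alt_concat w s a i).1 h
    have h5 := ih a h1
    have h6 := altCnt_mono (permFun w) (le_of_lt (show (a : ℕ) < i from h2))
    simp only [List.length_append, List.length_singleton]
    by_contra hlt
    have e1 : altCnt (permFun w) a = s.length + 1 := by omega
    have e2 : altCnt (permFun w) i = altCnt (permFun w) a := by omega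
    obtain ⟨d, hd⟩ := Nat.exists_eq_add_of_le (le_of_lt (show (a : ℕ) < i from h2))
    rw [hd] at e2
    by_cases hs : Even s.length
    · have := altCnt_const_odd _ _ _ e2 (by rw [e1]; exact hs.add_one)
      rw [← hd, permFun_val, permFun_val] at this
      have h7 : (w i : ℕ) < w a := h3 hs
      omega
    · have := altCnt_const_even _ _ _ e2 (by rw [e1, Nat.odd_add_one]; simpa using hs)
      rw [← hd, permFun_val, permFun_val] at this
      have h7 : (w a : ℕ) < w i := h4 hs
      omega

lemma alt_lower {n : ℕ} (w : Equiv.Perm (Fin n)) (i : ℕ) (hi : i < n) :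
    ∃ s : List (Fin n), IsAltSubseq w (s ++ [⟨i, hi⟩]) ∧
      s.length + 1 = altCnt (permFun w) i := by
  induction i with
  | zero => exact ⟨[], alt_singleton _ _, by simp [altCnt]⟩
  | succ i ih =>
    obtain ⟨s, h1, h2⟩ := ih (by omega)
    have hi' : i < n := by omega
    have v1 : permFun w i = w ⟨i, hi'⟩ := permFun_val w ⟨i, hi'⟩
    have v2 : permFun w (i + 1) = w ⟨i + 1, hi⟩ := permFun_val w ⟨i + 1, hi⟩
    have hne : w ⟨i, hi'⟩ ≠ w ⟨i + 1, hi⟩ := by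
      intro h; have := w.injective h; simp at this
    have hlt : (⟨i, hi'⟩ : Fin n) < ⟨i + 1, hi⟩ := by simp
    rw [altCnt, ← h2, v1, v2]
    split_ifs with h <;> rw [Nat.odd_add_one, Nat.not_odd_iff_even, Fin.val_fin_lt] at h
    · refine ⟨s, ?_, rfl⟩
      induction s using List.reverseRecOn with
      | nil => exact alt_singleton _ _
      | append_singleton s a _ =>
        obtain ⟨g1, g2, g3, g4⟩ := (alt_concat w s a _).1 h1
        refine (alt_concat w s a _).2 ⟨g1, g2.trans hlt, ?_, ?_⟩
        · intro he
          simp only [List.length_append, List.length_singleton, Nat.even_add_one, he] at h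
          have : w ⟨i + 1, hi⟩ < w ⟨i, hi'⟩ := lt_of_le_of_ne (not_lt.1 (by tauto)) hne.symm
          exact this.trans (g3 he)
        · intro he
          simp only [List.length_append, List.length_singleton, Nat.even_add_one, he] at h
          exact (g4 he).trans (by tauto)
    · refine ⟨s ++ [⟨i, hi'⟩], (alt_concat _ _ _ _).2 ⟨h1, hlt, ?_, ?_⟩, by simp⟩
      · intro he
        exact lt_of_le_of_ne (not_lt.1 (by tauto)) hne.symm
      · intro he
        tauto

lemma altSubseqLen_eq {m : ℕ} (w : Equiv.Perm (Fin (m + 2))) :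
    altSubseqLen w = altCnt (permFun w) (m + 1) := by
  unfold altSubseqLen
  apply IsGreatest.csSup_eq
  constructor
  · obtain ⟨s, h1, h2⟩ := alt_lower w (m + 1) (by omega)
    exact ⟨_, h1, by simpa using h2⟩
  · rintro k ⟨s, h1, rfl⟩
    induction s using List.reverseRecOn with
    | nil => simp
    | append_singleton s a _ =>
      have h2 := alt_upper w s a h1
      have h3 := altCnt_mono (permFun w) (show (a : ℕ) ≤ m + 1 by omega)
      simp; omega

lemma sum_desc {n : ℕ} (a b : Fin n) (hab : a ≠ b) :
    ∑ w : Equiv.Perm (Fin n), (if w a < w b then 0 else 1 : ℚ) = n.factorial / 2 := by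
  have h1 : ∑ w : Equiv.Perm (Fin n), (if w a < w b then 0 else 1 : ℚ) =
      ∑ w : Equiv.Perm (Fin n), (if w b < w a then 0 else 1 : ℚ) := by
    rw [← Equiv.sum_comp (Equiv.mulRight (Equiv.swap a b))]
    simp
  have h2 : ∑ w : Equiv.Perm (Fin n), (if w a < w b then 0 else 1 : ℚ) +
      ∑ w : Equiv.Perm (Fin n), (if w b < w a then 0 else 1 : ℚ) = n.factorial := by
    rw [← Finset.sum_add_distrib, Finset.sum_congr rfl (g := fun _ => (1 : ℚ))]
    · simp [Fintype.card_perm]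
    · intro w _
      have : w a ≠ w b := fun h => hab (w.injective h)
      rcases lt_or_gt_of_ne this with h | h <;> simp [h, not_lt.2 h.le]
  linarith

lemma sum_ext {n : ℕ} (a b c : Fin n) (hab : a ≠ b) (hbc : b ≠ c) (hac : a ≠ c) :
    ∑ w : Equiv.Perm (Fin n), (if (w a < w b ↔ w b < w c) then 0 else 1 : ℚ) =
      2 * n.factorial / 3 := by
  have h1 : ∑ w : Equiv.Perm (Fin n), (if (w a < w b ↔ w b < w c) then 0 else 1 : ℚ) =
      ∑ w : Equiv.Perm (Fin n), (if (w b < w a ↔ w a < w c) then 0 else 1 : ℚ) := by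
    rw [← Equiv.sum_comp (Equiv.mulRight (Equiv.swap a b))]
    simp [Equiv.swap_apply_of_ne_of_ne hac.symm hbc.symm]
  have h2 : ∑ w : Equiv.Perm (Fin n), (if (w a < w b ↔ w b < w c) then 0 else 1 : ℚ) =
      ∑ w : Equiv.Perm (Fin n), (if (w a < w c ↔ w c < w b) then 0 else 1 : ℚ) := by
    rw [← Equiv.sum_comp (Equiv.mulRight (Equiv.swap b c))]
    simp [Equiv.swap_apply_of_ne_of_ne hab hac]
  have h3 : ∑ w : Equiv.Perm (Fin n), (if (w a < w b ↔ w b < w c) then 0 else 1 : ℚ) +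
      ∑ w : Equiv.Perm (Fin n), (if (w b < w a ↔ w a < w c) then 0 else 1 : ℚ) +
      ∑ w : Equiv.Perm (Fin n), (if (w a < w c ↔ w c < w b) then 0 else 1 : ℚ)
       = 2 * n.factorial := by
    rw [← Finset.sum_add_distrib, ← Finset.sum_add_distrib,
      Finset.sum_congr rfl (g := fun _ => (2 : ℚ))]
    · simp [Fintype.card_perm]; ring
    · intro w _
      have e1 : w a ≠ w b := fun h => hab (w.injective h)
      have e2 : w b ≠ w c := fun h => hbc (w.injective h)
      have e3 : w a ≠ w c := fun h => hac (w.injective h)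
      generalize w a = x at *
      generalize w b = y at *
      generalize w c = z at *
      split_ifs <;> first | (exfalso; omega) | norm_num
  linarith

theorem mean_altSubseqLen (n : ℕ) (hn : 2 ≤ n) :
    ∑ w : Equiv.Perm (Fin n), (altSubseqLen w : ℚ) =
      (4 * n + 1) * (n.factorial : ℚ) / 6 := by
  obtain ⟨m, rfl⟩ := Nat.exists_eq_add_of_le' hn
  simp only [altSubseqLen_eq, altCnt_formula]
  push_cast
  rw [Finset.sum_add_distrib, Finset.sum_add_distrib, Finset.sum_comm]
  have h1 := sum_desc (n := m + 2) ⟨0, by omega⟩ ⟨1, by omega⟩ (by simp)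
  have h2 : ∀ j ∈ Finset.range m, ∑ w : Equiv.Perm (Fin (m + 2)),
      (if (permFun w j < permFun w (j + 1) ↔ permFun w (j + 1) < permFun w (j + 2))
        then 0 else 1 : ℚ) = 2 * (m + 2).factorial / 3 := by
    intro j hj
    have hj := Finset.mem_range.1 hj
    rw [← sum_ext (n := m + 2) ⟨j, by omega⟩ ⟨j + 1, by omega⟩ ⟨j + 2, by omega⟩
      (by simp) (by simp) (by simp)]
    refine Finset.sum_congr rfl fun w _ => ?_
    simp only [permFun, show j < m + 2 by omega, show j + 1 < m + 2 by omega,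
      show j + 2 < m + 2 by omega, dite_true, Fin.val_fin_lt]
  have h3 : ∑ w : Equiv.Perm (Fin (m + 2)), (if permFun w 0 < permFun w 1 then 0 else 1 : ℚ)
      = (m + 2).factorial / 2 := by
    rw [← h1]
    refine Finset.sum_congr rfl fun w _ => ?_
    simp only [permFun, show 0 < m + 2 by omega, show 1 < m + 2 by omega,
      dite_true, Fin.val_fin_lt]
  rw [Finset.sum_congr rfl h2, h3]
  simp [Fintype.card_perm]
  ring
end

section
/- Let n ≥ 2 and S ⊆ {1,…,n−1}. Then β_n(S) ≤ E_n, with equality if and only if S = {1,3,5,…} ∩ {1,…,n−1} or S = {2,4,6,…} ∩ {1,…,n−1}. Moreover, for any S, T ⊆ {1,…,n−1} with ω(S) strictly contained in ω(T), one has β_n(S) < β_n(T). -/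
/-- The value `w(j)` (0-indexed) as a natural number, or `0` if out of range. -/
def permVal {n : ℕ} (w : Equiv.Perm (Fin n)) (j : ℕ) : ℕ :=
  if h : j < n then (w ⟨j, h⟩ : ℕ) else 0

/-- The descent set of `w`, as a set of 0-indexed positions `j ∈ {0,…,n-2}`
(`j` corresponds to the 1-indexed descent position `i = j+1 ∈ {1,…,n-1}`). -/
def descSet {n : ℕ} (w : Equiv.Perm (Fin n)) : Finset ℕ :=
  (Finset.range (n - 1)).filter fun j => permVal w (j + 1) < permVal w j

/-- `β_n(S)`: the number of permutations of `{1,…,n}` with descent set `S`. -/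
noncomputable def betaN (n : ℕ) (S : Finset ℕ) : ℕ :=
  Nat.card {w : Equiv.Perm (Fin n) // descSet w = S}

/-- `ω(S)`: the positions `i` (0-indexed, `i ∈ {0,…,n-3}`) such that exactly one of
`i, i+1` lies in `S`. -/
def omegaSet (n : ℕ) (S : Finset ℕ) : Finset ℕ :=
  (Finset.range (n - 2)).filter fun i => (i ∈ S ∧ i + 1 ∉ S) ∨ (i ∉ S ∧ i + 1 ∈ S)

/-- word generating function, built from the left -/
noncomputable def lfun (s : ℕ → Bool) : ℕ → ℝ → ℝ
  | 0 => fun _ => 1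
  | n+1 => fun x => if s n then ∫ t in x..1, lfun s n t else ∫ t in (0:ℝ)..x, lfun s n t

/-- word generating function, built from the right -/
noncomputable def rfun (s : ℕ → Bool) : ℕ → ℕ → ℝ → ℝ
  | 0 => fun _ _ => 1
  | m+1 => fun p x => if s p then ∫ t in (0:ℝ)..x, rfun s m (p+1) t
      else ∫ t in x..1, rfun s m (p+1) t

lemma cont_up {f : ℝ → ℝ} (hf : Continuous f) : Continuous fun x => ∫ t in (0:ℝ)..x, f t :=
  intervalIntegral.continuous_primitive (fun a b => hf.intervalIntegrable a b) 0

lemma cont_dn {f : ℝ → ℝ} (hf : Continuous f) : Continuous fun x => ∫ t in x..1, f t := by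
  have : (fun x => ∫ t in x..1, f t) = fun x => - ∫ t in (1:ℝ)..x, f t := by
    funext x; rw [intervalIntegral.integral_symm]
  rw [this]
  exact (intervalIntegral.continuous_primitive (fun a b => hf.intervalIntegrable a b) 1).neg

lemma deriv_up {f : ℝ → ℝ} (hf : Continuous f) (x : ℝ) :
    HasDerivAt (fun x => ∫ t in (0:ℝ)..x, f t) (f x) x :=
  (hf.integral_hasStrictDerivAt 0 x).hasDerivAt

lemma deriv_dn {f : ℝ → ℝ} (hf : Continuous f) (x : ℝ) :
    HasDerivAt (fun x => ∫ t in x..1, f t) (- f x) x := by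
  have : (fun x => ∫ t in x..1, f t) = fun x => - ∫ t in (1:ℝ)..x, f t := by
    funext x; rw [intervalIntegral.integral_symm]
  rw [this]
  exact (hf.integral_hasStrictDerivAt 1 x).hasDerivAt.neg

lemma adj_up {f g : ℝ → ℝ} (hf : Continuous f) (hg : Continuous g) :
    ∫ x in (0:ℝ)..1, (∫ t in (0:ℝ)..x, f t) * g x
      = ∫ x in (0:ℝ)..1, f x * ∫ t in x..1, g t := by
  have h := intervalIntegral.integral_mul_deriv_eq_deriv_mul (a := 0) (b := 1)
    (u := fun x => ∫ t in (0:ℝ)..x, f t) (v := fun x => ∫ t in x..1, g t)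
    (u' := f) (v' := fun x => - g x)
    (fun x _ => deriv_up hf x) (fun x _ => deriv_dn hg x)
    (hf.intervalIntegrable _ _) (hg.neg.intervalIntegrable _ _)
  simp only [mul_neg, intervalIntegral.integral_neg, intervalIntegral.integral_same] at h
  linarith

lemma lfun_cont (s : ℕ → Bool) (n : ℕ) : Continuous (lfun s n) := by
  induction n with
  | zero => exact continuous_const
  | succ n ih =>
    unfold lfun
    cases s n
    · simpa using cont_up ih
    · simpa using cont_dn ih

lemma rfun_cont (s : ℕ → Bool) (m : ℕ) : ∀ p, Continuous (rfun s m p) := by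
  induction m with
  | zero => intro p; exact continuous_const
  | succ n ih =>
    intro p
    unfold rfun
    cases s p
    · simpa using cont_dn (ih (p+1))
    · simpa using cont_up (ih (p+1))

lemma split_int (s : ℕ → Bool) (m : ℕ) : ∀ p,
    ∫ x in (0:ℝ)..1, lfun s (p+m) x = ∫ x in (0:ℝ)..1, lfun s p x * rfun s m p x := by
  induction m with
  | zero => intro p; simp [rfun]
  | succ m ih =>
    intro p
    rw [show p + (m+1) = (p+1)+m by ring, ih (p+1)]
    have e1 := adj_up (lfun_cont s p) (rfun_cont s m (p+1))
    have e2 := adj_up (rfun_cont s m (p+1)) (lfun_cont s p)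
    cases h : s p
    · simpa [lfun, rfun, h] using e1
    · simp only [lfun, rfun, h, if_true]
      simp only [mul_comm] at e2 ⊢
      exact e2.symm

lemma int_up_refl (f : ℝ → ℝ) (x : ℝ) :
    ∫ t in (0:ℝ)..x, f (1 - t) = ∫ t in (1-x)..1, f t := by
  simp

lemma int_dn_refl (f : ℝ → ℝ) (x : ℝ) :
    ∫ t in x..1, f (1 - t) = ∫ t in (0:ℝ)..(1-x), f t := by
  simp

lemma lfun_congr {s s' : ℕ → Bool} (n : ℕ) (h : ∀ i < n, s i = s' i) : lfun s n = lfun s' n := by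
  induction n with
  | zero => rfl
  | succ n ih =>
    unfold lfun
    rw [ih fun i hi => h i (by omega), h n (by omega)]

lemma lfun_compl {s s' : ℕ → Bool} (n : ℕ) (h : ∀ i < n, s' i = !s i) :
    lfun s' n = fun x => lfun s n (1-x) := by
  induction n with
  | zero => rfl
  | succ n ih =>
    unfold lfun
    rw [ih fun i hi => h i (by omega), h n (by omega)]
    funext x
    cases s n <;> simp

lemma rfun_compl {s s' : ℕ → Bool} (m : ℕ) : ∀ p, (∀ i, p ≤ i → i < p + m → s' i = !s i) →
    rfun s' m p = fun x => rfun s m p (1-x) := by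
  induction m with
  | zero => intro p h; rfl
  | succ n ih =>
    intro p h
    unfold rfun
    rw [ih (p+1) fun i hi hi' => h i (by omega) (by omega), h p (by omega) (by omega)]
    funext x
    cases s p <;> simp

lemma pos_up {f : ℝ → ℝ} (hf : Continuous f) (h : ∀ x ∈ Set.Ioo (0:ℝ) 1, 0 < f x)
    {a b : ℝ} (ha : 0 ≤ a) (hb : b ≤ 1) (hab : a < b) : 0 < ∫ t in a..b, f t :=
  intervalIntegral.intervalIntegral_pos_of_pos_on (hf.intervalIntegrable _ _)
    (fun x hx => h x ⟨lt_of_le_of_lt ha hx.1, lt_of_lt_of_le hx.2 hb⟩) hab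

lemma lfun_pos (s : ℕ → Bool) (n : ℕ) : ∀ x ∈ Set.Ioo (0:ℝ) 1, 0 < lfun s n x := by
  induction n with
  | zero => intro x _; simp [lfun]
  | succ n ih =>
    intro x hx
    unfold lfun
    cases s n
    · simpa using pos_up (lfun_cont s n) ih le_rfl hx.2.le hx.1
    · simpa using pos_up (lfun_cont s n) ih hx.1.le le_rfl hx.2

lemma rfun_pos (s : ℕ → Bool) (m : ℕ) : ∀ p, ∀ x ∈ Set.Ioo (0:ℝ) 1, 0 < rfun s m p x := by
  induction m with
  | zero => intro p x _; simp [rfun]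
  | succ n ih =>
    intro p x hx
    unfold rfun
    cases s p
    · simpa using pos_up (rfun_cont s n (p+1)) (ih (p+1)) hx.1.le le_rfl hx.2
    · simpa using pos_up (rfun_cont s n (p+1)) (ih (p+1)) le_rfl hx.2.le hx.1

lemma up_strict {f : ℝ → ℝ} (hf : Continuous f) (h : ∀ x ∈ Set.Ioo (0:ℝ) 1, 0 < f x)
    {a b : ℝ} (ha : 0 ≤ a) (hb : b ≤ 1) (hab : a < b) :
    ∫ t in (0:ℝ)..a, f t < ∫ t in (0:ℝ)..b, f t := by
  have := intervalIntegral.integral_add_adjacent_intervals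
    (hf.intervalIntegrable (μ := MeasureTheory.volume) 0 a) (hf.intervalIntegrable a b)
  have := pos_up hf h ha hb hab
  linarith

lemma dn_strict {f : ℝ → ℝ} (hf : Continuous f) (h : ∀ x ∈ Set.Ioo (0:ℝ) 1, 0 < f x)
    {a b : ℝ} (ha : 0 ≤ a) (hb : b ≤ 1) (hab : a < b) :
    ∫ t in b..1, f t < ∫ t in a..1, f t := by
  have := intervalIntegral.integral_add_adjacent_intervals
    (hf.intervalIntegrable (μ := MeasureTheory.volume) a b) (hf.intervalIntegrable b 1)
  have := pos_up hf h ha hb hab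
  linarith

/-- Chebyshev-type inequality -/
lemma cheb {F G : ℝ → ℝ} (hF : Continuous F) (hG : Continuous G)
    (h : ∀ a b : ℝ, 0 ≤ a → b ≤ 1 → a < b → 0 < (F b - F a) * (G a - G b)) :
    ∫ x in (0:ℝ)..1, F x * G x < ∫ x in (0:ℝ)..1, F x * G (1-x) := by
  have key : 0 < ∫ x in (0:ℝ)..1, (F x - F (1-x)) * (G (1-x) - G x) := by
    apply intervalIntegral.integral_pos (by norm_num)
    · exact Continuous.continuousOn (by fun_prop)
    · intro x hx
      rcases lt_trichotomy x (1-x) with h1 | h1 | h1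
      · have := h x (1-x) hx.1.le (by linarith [hx.1]) h1
        nlinarith
      · rw [← h1]; simp
      · exact (h (1-x) x (by linarith [hx.2]) hx.2 h1).le
    · exact ⟨1, by simp, by simpa using h 0 1 le_rfl le_rfl one_pos⟩
  have e1 : ∫ x in (0:ℝ)..1, F (1-x) * G (1-x) = ∫ x in (0:ℝ)..1, F x * G x := by
    have := intervalIntegral.integral_comp_sub_left (a := 0) (b := 1) (fun x => F x * G x) 1
    simpa using this
  have e2 : ∫ x in (0:ℝ)..1, F (1-x) * G x = ∫ x in (0:ℝ)..1, F x * G (1-x) := by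
    have := intervalIntegral.integral_comp_sub_left (a := 0) (b := 1) (fun x => F x * G (1-x)) 1
    simpa using this
  have i1 : IntervalIntegrable (fun x => F x * G (1-x)) MeasureTheory.volume 0 1 :=
    Continuous.intervalIntegrable (by fun_prop) _ _
  have i2 : IntervalIntegrable (fun x => F (1-x) * G x) MeasureTheory.volume 0 1 :=
    Continuous.intervalIntegrable (by fun_prop) _ _
  have i3 : IntervalIntegrable (fun x => F x * G x) MeasureTheory.volume 0 1 :=
    Continuous.intervalIntegrable (by fun_prop) _ _
  have i4 : IntervalIntegrable (fun x => F (1-x) * G (1-x)) MeasureTheory.volume 0 1 :=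
    Continuous.intervalIntegrable (by fun_prop) _ _
  have e3 : ∫ x in (0:ℝ)..1, (F x - F (1-x)) * (G (1-x) - G x)
      = ∫ x in (0:ℝ)..1, ((F x * G (1-x) + F (1-x) * G x) - (F x * G x + F (1-x) * G (1-x))) := by
    congr 1; funext x; ring
  rw [e3, intervalIntegral.integral_sub (i1.add i2) (i3.add i4),
    intervalIntegral.integral_add i1 i2, intervalIntegral.integral_add i3 i4, e1, e2] at key
  linarith

lemma step_lt {s s' : ℕ → Bool} {N p : ℕ} (hp : p + 1 < N) (hs : s p = s (p+1))
    (h1 : ∀ i ≤ p, s' i = s i) (h2 : ∀ i, p < i → i < N → s' i = !s i) :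
    ∫ x in (0:ℝ)..1, lfun s N x < ∫ x in (0:ℝ)..1, lfun s' N x := by
  obtain ⟨m, rfl⟩ : ∃ m, N = (p+1) + (m+1) := ⟨N - p - 2, by omega⟩
  rw [split_int, split_int, lfun_congr (s := s') (s' := s) (p+1) fun i hi => h1 i (by omega),
    rfun_compl (s := s) (s' := s') (m+1) (p+1) fun i hi hi' => h2 i (by omega) (by omega)]
  apply cheb (lfun_cont _ _) (rfun_cont _ _ _)
  intro a b ha hb hab
  cases h : s p
  · have h' := hs ▸ h
    have l := up_strict (lfun_cont s p) (lfun_pos s p) ha hb hab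
    have r := dn_strict (rfun_cont s m (p+2)) (rfun_pos s m (p+2)) ha hb hab
    simp only [lfun, rfun, h, h']
    exact mul_pos (sub_pos.2 (by simpa using l)) (sub_pos.2 (by simpa using r))
  · have h' := hs ▸ h
    have l := dn_strict (lfun_cont s p) (lfun_pos s p) ha hb hab
    have r := up_strict (rfun_cont s m (p+2)) (rfun_pos s m (p+2)) ha hb hab
    simp only [lfun, rfun, h, h']
    exact mul_pos_of_neg_of_neg (sub_neg.2 (by simpa using l)) (sub_neg.2 (by simpa using r))

lemma compl_eq {s s' : ℕ → Bool} (N : ℕ) (h : ∀ i < N, s' i = !s i) :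
    ∫ x in (0:ℝ)..1, lfun s' N x = ∫ x in (0:ℝ)..1, lfun s N x := by
  rw [lfun_compl N h]; simp

/-! monotonicity in omega -/
def sOf (E : Finset ℕ) : ℕ → Bool
  | 0 => false
  | i+1 => xor (sOf E i) (decide (i ∈ E))

lemma sOf_insert_le (E : Finset ℕ) (p : ℕ) : ∀ i ≤ p, sOf (insert p E) i = sOf E i := by
  intro i
  induction i with
  | zero => intro _; rfl
  | succ i ih =>
    intro hi
    have : i ≠ p := by omega
    simp [sOf, ih (by omega), this]

lemma sOf_insert_gt (E : Finset ℕ) (p : ℕ) (hp : p ∉ E) :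
    ∀ i, p < i → sOf (insert p E) i = !sOf E i := by
  intro i
  induction i with
  | zero => intro h; omega
  | succ i ih =>
    intro hi
    rcases Nat.lt_or_ge p i with h | h
    · have : i ≠ p := by omega
      simp [sOf, ih h, this]
    · obtain rfl : i = p := by omega
      simp [sOf, sOf_insert_le, hp]

lemma c_insert (N : ℕ) (E : Finset ℕ) (p : ℕ) (hp : p ∉ E) (hN : p + 1 < N) :
    ∫ x in (0:ℝ)..1, lfun (sOf E) N x < ∫ x in (0:ℝ)..1, lfun (sOf (insert p E)) N x := by
  apply step_lt hN
  · simp [sOf, hp]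
  · exact sOf_insert_le E p
  · intro i h _; exact sOf_insert_gt E p hp i h

lemma c_le (N : ℕ) (E D : Finset ℕ) (hD : ∀ i ∈ D, i + 1 < N) :
    ∫ x in (0:ℝ)..1, lfun (sOf E) N x ≤ ∫ x in (0:ℝ)..1, lfun (sOf (D ∪ E)) N x := by
  induction D using Finset.induction_on with
  | empty => simp
  | insert a D ha ih =>
    have ih := ih fun i hi => hD i (by simp [hi])
    rw [Finset.insert_union]
    by_cases h : a ∈ D ∪ E
    · rwa [Finset.insert_eq_of_mem h]
    · exact ih.trans (c_insert N _ a h (hD a (by simp))).le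

lemma c_lt (N : ℕ) (E D : Finset ℕ) (hD : ∀ i ∈ D, i + 1 < N) (h : E ⊂ D) :
    ∫ x in (0:ℝ)..1, lfun (sOf E) N x < ∫ x in (0:ℝ)..1, lfun (sOf D) N x := by
  obtain ⟨a, ha, hE⟩ := Finset.exists_of_ssubset h
  have h1 := c_insert N E a hE (hD a ha)
  have h2 := c_le N (insert a E) D hD
  rw [Finset.union_eq_left.2 (Finset.insert_subset ha h.1)] at h2
  exact h1.trans_le h2

lemma hda {f g : ℝ → ℝ} {f' g' x : ℝ} (h : HasDerivAt f f' x) (e : g = f) (e' : g' = f') :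
    HasDerivAt g g' x := by
  subst e e'; exact h

/-- divided-power monomial `x^i/i! * (1-x)^j/j!` -/
noncomputable def bern (i j : ℕ) (x : ℝ) : ℝ :=
  x ^ i / (i.factorial : ℝ) * ((1 - x) ^ j / (j.factorial : ℝ))

lemma bern_cont (i j : ℕ) : Continuous (bern i j) := by
  unfold bern; fun_prop

lemma dpow_deriv (i : ℕ) (x : ℝ) :
    HasDerivAt (fun x : ℝ => x ^ (i+1) / ((i+1).factorial : ℝ)) (x ^ i / (i.factorial : ℝ)) x := by
  have h := (hasDerivAt_pow (i+1) x).div_const ((i+1).factorial : ℝ)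
  refine hda h rfl ?_
  have : (i.factorial : ℝ) ≠ 0 := by positivity
  rw [Nat.factorial_succ]; push_cast
  have : (i : ℝ) + 1 ≠ 0 := by positivity
  field_simp

lemma dpow_deriv' (i : ℕ) (x : ℝ) :
    HasDerivAt (fun x : ℝ => (1 - x) ^ (i+1) / ((i+1).factorial : ℝ))
      (-((1 - x) ^ i / (i.factorial : ℝ))) x := by
  have h := (dpow_deriv i (1 - x)).comp x ((hasDerivAt_id x).const_sub 1)
  refine hda h rfl ?_
  simp

lemma bern_deriv (i j : ℕ) (x : ℝ) :
    HasDerivAt (bern (i+1) (j+1)) (bern i (j+1) x - bern (i+1) j x) x := by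
  have h := (dpow_deriv i x).mul (dpow_deriv' j x)
  refine hda h rfl ?_
  unfold bern; ring

lemma bern_deriv_right (i : ℕ) (x : ℝ) :
    HasDerivAt (bern (i+1) 0) (bern i 0 x) x := by
  have h := dpow_deriv i x
  refine hda h ?_ ?_
  · funext y; simp [bern]
  · simp [bern]

lemma bern_deriv_left (j : ℕ) (x : ℝ) :
    HasDerivAt (bern 0 (j+1)) (-bern 0 j x) x := by
  have h := dpow_deriv' j x
  refine hda h ?_ ?_
  · funext y; simp [bern]
  · simp [bern]

lemma bern_sum_up (m : ℕ) : ∀ (j : ℕ) (x : ℝ),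
    HasDerivAt (fun x => ∑ i ∈ Finset.range (m+1), bern (j+1+i) (m-i) x) (bern j m x) x := by
  induction m with
  | zero => intro j x; simpa using bern_deriv_right j x
  | succ m ih =>
    intro j x
    have h := (ih (j+1) x).add (bern_deriv j m x)
    refine hda h ?_ ?_
    · funext y
      simp only [Pi.add_apply]
      rw [Finset.sum_range_succ']
      congr 1
      apply Finset.sum_congr rfl
      intro i _
      rw [show j + 1 + (i+1) = j+1+1+i by ring, Nat.add_sub_add_right]
    · ring

lemma bern_sum_dn (j : ℕ) : ∀ (m : ℕ) (x : ℝ),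
    HasDerivAt (fun x => ∑ k ∈ Finset.range (j+1), bern k (m+1+j-k) x) (-bern j m x) x := by
  induction j with
  | zero => intro m x; simpa using bern_deriv_left m x
  | succ j ih =>
    intro m x
    have h := (ih (m+1) x).add (bern_deriv j m x)
    refine hda h ?_ ?_
    · funext y
      simp only [Pi.add_apply]
      rw [Finset.sum_range_succ]
      congr 1
      · apply Finset.sum_congr rfl
        intro i _
        rw [show m + 1 + (j+1) = m+1+1+j by ring]
      · rw [Nat.add_sub_cancel]
    · ring

lemma bern_zero (i j : ℕ) : bern (i+1) j 0 = 0 := by simp [bern]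
lemma bern_one (i j : ℕ) : bern i (j+1) 1 = 0 := by simp [bern]

lemma int_bern_up (j m : ℕ) (x : ℝ) :
    ∫ t in (0:ℝ)..x, bern j m t = ∑ i ∈ Finset.range (m+1), bern (j+1+i) (m-i) x := by
  rw [intervalIntegral.integral_eq_sub_of_hasDerivAt (fun y _ => bern_sum_up m j y)
    ((bern_cont j m).intervalIntegrable _ _)]
  have : ∑ i ∈ Finset.range (m+1), bern (j+1+i) (m-i) 0 = 0 := by
    apply Finset.sum_eq_zero
    intro i _
    rw [show j+1+i = (j+i)+1 by ring, bern_zero]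
  rw [this, sub_zero]

lemma int_bern_dn (j m : ℕ) (x : ℝ) :
    ∫ t in x..1, bern j m t = ∑ k ∈ Finset.range (j+1), bern k (m+1+j-k) x := by
  have h := intervalIntegral.integral_eq_sub_of_hasDerivAt (a := x) (b := 1)
    (fun y _ => bern_sum_dn j m y) ((bern_cont j m).neg.intervalIntegrable _ _)
  have : ∑ k ∈ Finset.range (j+1), bern k (m+1+j-k) 1 = 0 := by
    apply Finset.sum_eq_zero
    intro i hi
    have := Finset.mem_range.1 hi
    rw [show m+1+j-i = (m+j-i)+1 by omega, bern_one]
  rw [this, intervalIntegral.integral_neg] at h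
  linarith

lemma int_bern (j m : ℕ) : ∫ t in (0:ℝ)..1, bern j m t = 1 / ((j+m+1).factorial : ℝ) := by
  rw [int_bern_up, Finset.sum_range_succ, Finset.sum_eq_zero]
  · simp [bern]; ring_nf
  · intro i hi
    have := Finset.mem_range.1 hi
    rw [show m-i = (m-i-1)+1 by omega, bern_one]

lemma fin_up (n j : ℕ) (hj : j ≤ n) (x : ℝ) :
    ∑ k : Fin (n+2), (if j < k.val then bern k (n+1-k) x else 0)
      = ∫ t in (0:ℝ)..x, bern j (n-j) t := by
  obtain ⟨m, rfl⟩ := Nat.exists_eq_add_of_le hj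
  rw [Fin.sum_univ_eq_sum_range (fun k => if j < k then bern k (j+m+1-k) x else 0) (j+m+2),
    int_bern_up, show j+m+2 = (j+1) + (m+1) by ring, Finset.sum_range_add,
    Finset.sum_eq_zero, zero_add, Nat.add_sub_cancel_left]
  · apply Finset.sum_congr rfl
    intro i _
    rw [if_pos (by omega), show j + m + 1 - (j+1+i) = m - i by omega]
  · intro i hi
    have := Finset.mem_range.1 hi
    rw [if_neg (by omega)]

lemma fin_dn (n j : ℕ) (hj : j ≤ n) (x : ℝ) :
    ∑ k : Fin (n+2), (if k.val ≤ j then bern k (n+1-k) x else 0)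
      = ∫ t in x..1, bern j (n-j) t := by
  obtain ⟨m, rfl⟩ := Nat.exists_eq_add_of_le hj
  rw [Fin.sum_univ_eq_sum_range (fun k => if k ≤ j then bern k (j+m+1-k) x else 0) (j+m+2),
    int_bern_dn, show j+m+2 = (j+1) + (m+1) by ring, Finset.sum_range_add, add_comm,
    Finset.sum_eq_zero, zero_add, Nat.add_sub_cancel_left]
  · apply Finset.sum_congr rfl
    intro i hi
    have := Finset.mem_range.1 hi
    rw [if_pos (by omega), show j + m + 1 - i = m + 1 + j - i by omega]
  · intro i hi
    rw [if_neg (by omega)]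

/-- `w` has descent word `s`. -/
def Mat (s : ℕ → Bool) {n : ℕ} (w : Equiv.Perm (Fin (n+1))) : Prop :=
  ∀ i : Fin n, (w i.succ < w i.castSucc ↔ s i = true)

/-- Insert a last value `k`. -/
def ins {n : ℕ} (k : Fin (n+1)) (w : Equiv.Perm (Fin n)) : Equiv.Perm (Fin (n+1)) :=
  (finSuccEquiv' (Fin.last n)).trans ((Equiv.optionCongr w).trans (finSuccEquiv' k).symm)

lemma ins_last {n : ℕ} (k : Fin (n+1)) (w : Equiv.Perm (Fin n)) : ins k w (Fin.last n) = k := by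
  simp [ins]

lemma ins_cast {n : ℕ} (k : Fin (n+1)) (w : Equiv.Perm (Fin n)) (i : Fin n) :
    ins k w i.castSucc = k.succAbove (w i) := by
  have h : finSuccEquiv' (Fin.last n) i.castSucc = some i := by
    rw [← Fin.succAbove_last_apply, finSuccEquiv'_succAbove]
  simp [ins, h]

lemma ins_bij (n : ℕ) : Function.Bijective
    (fun p : Equiv.Perm (Fin n) × Fin (n+1) => ins p.2 p.1) := by
  rw [Fintype.bijective_iff_injective_and_card]
  constructor
  · rintro ⟨w, k⟩ ⟨w', k'⟩ h
    simp only at h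
    have hk : k = k' := by rw [← ins_last k w, h, ins_last]
    subst hk
    congr 1
    ext i
    have := ins_cast k w i
    rw [h, ins_cast] at this
    rw [Fin.succAbove_right_injective this]
  · simp [Fintype.card_perm, Nat.factorial_succ, mul_comm]

lemma mat_ins (s : ℕ → Bool) {n : ℕ} (k : Fin (n+2)) (w : Equiv.Perm (Fin (n+1))) :
    Mat s (ins k w) ↔ Mat s w ∧ (k.val ≤ (w (Fin.last n)).val ↔ s n = true) := by
  unfold Mat
  rw [Fin.forall_fin_succ']
  apply and_congr
  · apply forall_congr'
    intro i
    rw [← Fin.castSucc_succ, ins_cast, ins_cast, Fin.succAbove_lt_succAbove_iff]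
    simp
  · rw [Fin.succ_last, ins_last, ins_cast, Fin.lt_succAbove_iff_le_castSucc]
    simp [Fin.le_def]

open Classical in
lemma lfun_eq (s : ℕ → Bool) (n : ℕ) : ∀ x : ℝ, lfun s n x =
    ∑ w : Equiv.Perm (Fin (n+1)), if Mat s w then
      bern (w (Fin.last n)) (n - w (Fin.last n)) x else 0 := by
  induction n with
  | zero => intro x; simp [lfun, Mat, bern]
  | succ n ih =>
    intro x
    rw [← (ins_bij (n+1)).sum_comp, Fintype.sum_prod_type]
    have key : ∀ w : Equiv.Perm (Fin (n+1)),
        ∑ k : Fin (n+2), (if Mat s (ins k w) then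
          bern (ins k w (Fin.last (n+1))) (n + 1 - ins k w (Fin.last (n+1))) x else 0)
        = if Mat s w then (if s n then ∫ t in x..1, bern (w (Fin.last n)) (n - w (Fin.last n)) t
          else ∫ t in (0:ℝ)..x, bern (w (Fin.last n)) (n - w (Fin.last n)) t) else 0 := by
      intro w
      simp only [mat_ins, ins_last]
      have hj : (w (Fin.last n)).val ≤ n := by omega
      by_cases hw : Mat s w
      · cases h : s n
        · simpa [hw] using fin_up n _ hj x
        · simpa [hw] using fin_dn n _ hj x
      · simp [hw]
    simp only [key]
    have hi : ∀ a b : ℝ, ∫ t in a..b, lfun s n t = ∑ w : Equiv.Perm (Fin (n+1)),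
        if Mat s w then ∫ t in a..b, bern (w (Fin.last n)) (n - w (Fin.last n)) t else 0 := by
      intro a b
      simp only [ih]
      rw [intervalIntegral.integral_finsetSum]
      · apply Finset.sum_congr rfl
        intro w _
        split_ifs <;> simp
      · intro w _
        split_ifs
        · exact (bern_cont _ _).intervalIntegrable _ _
        · simp
    simp only [lfun, hi]
    cases s n <;> simp

open Classical in
lemma int_lfun (s : ℕ → Bool) (n : ℕ) :
    ∫ x in (0:ℝ)..1, lfun s n x =
      (Nat.card {w : Equiv.Perm (Fin (n+1)) // Mat s w} : ℝ) / ((n+1).factorial : ℝ) := by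
  simp only [lfun_eq]
  rw [intervalIntegral.integral_finsetSum]
  · have : ∀ w : Equiv.Perm (Fin (n+1)), (∫ x in (0:ℝ)..1, if Mat s w then
      bern (w (Fin.last n)) (n - w (Fin.last n)) x else 0)
        = if Mat s w then 1 / ((n+1).factorial : ℝ) else 0 := by
      intro w
      split_ifs
      · rw [int_bern, show ((w (Fin.last n)).val + (n - (w (Fin.last n)).val) + 1) = n+1 by omega]
      · simp
    simp only [this]
    rw [← Finset.sum_filter, Finset.sum_const, Nat.card_eq_fintype_card, Fintype.card_subtype]
    simp [div_eq_mul_inv]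
  · intro w _
    split_ifs
    · exact (bern_cont _ _).intervalIntegrable _ _
    · simp

lemma descSet_iff {N : ℕ} (w : Equiv.Perm (Fin (N+1))) (S : Finset ℕ)
    (hS : S ⊆ Finset.range N) : descSet w = S ↔ Mat (fun i => decide (i ∈ S)) w := by
  unfold descSet Mat
  rw [Finset.ext_iff]
  simp only [Nat.add_sub_cancel, Finset.mem_filter, Finset.mem_range, decide_eq_true_eq]
  have hv : ∀ i : Fin N, (permVal w (i.val+1) < permVal w i.val ↔ w i.succ < w i.castSucc) := by
    intro i
    have h1 : i.val + 1 < N + 1 := by omega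
    have h2 : i.val < N + 1 := by omega
    unfold permVal
    rw [dif_pos h1, dif_pos h2]
    exact Iff.rfl
  constructor
  · intro h i
    rw [← hv, ← h i.val]
    simp
  · intro h i
    constructor
    · rintro ⟨hi, hlt⟩
      exact (h ⟨i, hi⟩).1 ((hv ⟨i, hi⟩).1 hlt)
    · intro hi
      have hN := Finset.mem_range.1 (hS hi)
      exact ⟨hN, (hv ⟨i, hN⟩).2 ((h ⟨i, hN⟩).2 hi)⟩

lemma betaN_eq {N : ℕ} (S : Finset ℕ) (hS : S ⊆ Finset.range N) :
    (betaN (N+1) S : ℝ) =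
      ((N+1).factorial : ℝ) * ∫ x in (0:ℝ)..1, lfun (fun i => decide (i ∈ S)) N x := by
  rw [int_lfun, betaN, Nat.card_congr (Equiv.subtypeEquivRight fun w => descSet_iff w S hS)]
  field_simp

lemma sOf_omega (N : ℕ) (S : Finset ℕ) : ∀ i < N,
    sOf (omegaSet (N+1) S) i = xor (decide (i ∈ S)) (decide (0 ∈ S)) := by
  intro i
  induction i with
  | zero => intro _; simp [sOf]
  | succ i ih =>
    intro hi
    have h1 : i < N - 1 := by omega
    rw [sOf, ih (by omega)]
    by_cases a : i ∈ S <;> by_cases b : i + 1 ∈ S <;> by_cases c : 0 ∈ S <;>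
      simp [omegaSet, a, b, c, h1]

lemma betaN_omega {N : ℕ} (S : Finset ℕ) (hS : S ⊆ Finset.range N) :
    (betaN (N+1) S : ℝ) =
      ((N+1).factorial : ℝ) * ∫ x in (0:ℝ)..1, lfun (sOf (omegaSet (N+1) S)) N x := by
  rw [betaN_eq S hS]
  congr 1
  by_cases h : 0 ∈ S
  · apply compl_eq
    intro i hi
    simp [sOf_omega N S i hi, h]
  · rw [lfun_congr N]
    intro i hi
    simp [sOf_omega N S i hi, h]

lemma betaN_lt {N : ℕ} (S T : Finset ℕ) (hS : S ⊆ Finset.range N) (hT : T ⊆ Finset.range N)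
    (h : omegaSet (N+1) S ⊂ omegaSet (N+1) T) : betaN (N+1) S < betaN (N+1) T := by
  have := c_lt N _ _ (fun i hi => by
    have := Finset.mem_range.1 (Finset.mem_filter.1 hi).1
    omega) h
  have : (betaN (N+1) S : ℝ) < betaN (N+1) T := by
    rw [betaN_omega S hS, betaN_omega T hT]
    exact mul_lt_mul_of_pos_left this (by positivity)
  exact_mod_cast this

lemma betaN_congr {N : ℕ} (S T : Finset ℕ) (hS : S ⊆ Finset.range N) (hT : T ⊆ Finset.range N)
    (h : omegaSet (N+1) S = omegaSet (N+1) T) : betaN (N+1) S = betaN (N+1) T := by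
  have : (betaN (N+1) S : ℝ) = betaN (N+1) T := by
    rw [betaN_omega S hS, betaN_omega T hT, h]
  exact_mod_cast this

lemma euler_eq (N : ℕ) : eulerNumber (N+1) = betaN (N+1) ((Finset.range N).filter Even) := by
  unfold eulerNumber betaN
  apply Nat.card_congr
  apply Equiv.subtypeEquivRight
  intro w
  rw [descSet_iff w _ (Finset.filter_subset _ _)]
  unfold IsAltPerm Mat
  have hne : ∀ i : Fin N, w i.castSucc ≠ w i.succ := by
    intro i h
    exact absurd (w.injective h) (ne_of_lt i.castSucc_lt_succ)
  constructor
  · intro h i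
    have h' := h i.val (by omega)
    simp only [Finset.mem_filter, Finset.mem_range, i.isLt, true_and, decide_eq_true_eq]
    constructor
    · intro hlt
      by_contra hc
      exact lt_asymm hlt (h'.2 hc)
    · exact h'.1
  · intro h j hj
    have h' := h ⟨j, by omega⟩
    simp only [Finset.mem_filter, Finset.mem_range, decide_eq_true_eq] at h'
    constructor
    · intro he
      exact h'.2 ⟨by omega, he⟩
    · intro ho
      rcases lt_or_gt_of_ne (hne ⟨j, by omega⟩) with h1 | h1
      · exact h1
      · exact absurd (h'.1 h1).2 ho

lemma omega_even (N : ℕ) :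
    omegaSet (N+1) ((Finset.range N).filter Even) = Finset.range (N-1) := by
  ext i
  simp only [omegaSet, Finset.mem_filter, Finset.mem_range]
  have := Nat.even_add_one (n := i)
  constructor
  · rintro ⟨h, _⟩; omega
  · intro h
    have h1 : i < N := by omega
    have h2 : i + 1 < N := by omega
    refine ⟨by omega, ?_⟩
    by_cases he : Even i <;> simp [h1, h2, he, this]

lemma omega_odd (N : ℕ) :
    omegaSet (N+1) ((Finset.range N).filter Odd) = Finset.range (N-1) := by
  ext i
  simp only [omegaSet, Finset.mem_filter, Finset.mem_range]
  have := Nat.odd_add_one (n := i)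
  constructor
  · rintro ⟨h, _⟩; omega
  · intro h
    have h1 : i < N := by omega
    have h2 : i + 1 < N := by omega
    refine ⟨by omega, ?_⟩
    by_cases he : Odd i <;> simp [h1, h2, he, this]

lemma alt_of_omega {N : ℕ} (S : Finset ℕ) (h : omegaSet (N+1) S = Finset.range (N-1)) :
    ∀ i < N, (i ∈ S ↔ (Even i ↔ 0 ∈ S)) := by
  intro i
  induction i with
  | zero => intro _; simp
  | succ i ih =>
    intro hi
    have ih := ih (by omega)
    have hm : i ∈ omegaSet (N+1) S := by rw [h]; exact Finset.mem_range.2 (by omega)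
    have := (Finset.mem_filter.1 hm).2
    rw [Nat.even_add_one]
    tauto

theorem descent_set_inequalities (n : ℕ) (hn : 2 ≤ n) :
    (∀ S : Finset ℕ, S ⊆ Finset.range (n - 1) →
      betaN n S ≤ eulerNumber n ∧
      (betaN n S = eulerNumber n ↔
        S = (Finset.range (n - 1)).filter Even ∨
        S = (Finset.range (n - 1)).filter Odd)) ∧
    (∀ S T : Finset ℕ, S ⊆ Finset.range (n - 1) → T ⊆ Finset.range (n - 1) →
      omegaSet n S ⊂ omegaSet n T → betaN n S < betaN n T) := by
  obtain ⟨N, rfl⟩ : ∃ N, n = N + 1 := ⟨n - 1, by omega⟩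
  simp only [Nat.add_sub_cancel]
  refine ⟨?_, fun S T hS hT h => betaN_lt S T hS hT h⟩
  intro S hS
  have hsub : omegaSet (N+1) S ⊆ omegaSet (N+1) ((Finset.range N).filter Even) := by
    rw [omega_even]
    exact Finset.filter_subset _ _
  rw [euler_eq]
  rcases hsub.eq_or_ssubset with h | h
  · have hb := betaN_congr S _ hS (Finset.filter_subset _ _) h
    refine ⟨hb.le, fun _ => ?_, fun _ => hb⟩
    rw [omega_even] at h
    have ha := alt_of_omega S h
    by_cases h0 : 0 ∈ S
    · left
      ext i
      simp only [Finset.mem_filter, Finset.mem_range]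
      constructor
      · intro hi
        have hN := Finset.mem_range.1 (hS hi)
        exact ⟨hN, ((ha i hN).1 hi).2 h0⟩
      · rintro ⟨hN, he⟩
        exact (ha i hN).2 (by tauto)
    · right
      ext i
      simp only [Finset.mem_filter, Finset.mem_range, ← Nat.not_even_iff_odd]
      constructor
      · intro hi
        have hN := Finset.mem_range.1 (hS hi)
        exact ⟨hN, fun he => h0 (((ha i hN).1 hi).1 he)⟩
      · rintro ⟨hN, he⟩
        exact (ha i hN).2 (by tauto)
  · have hb := betaN_lt S _ hS (Finset.filter_subset _ _) h
    refine ⟨hb.le, fun he => absurd he hb.ne, ?_⟩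
    rintro (rfl | rfl)
    · exact (h.ne rfl).elim
    · rw [omega_even, omega_odd] at h
      exact (h.ne rfl).elim
end
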